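/- arXiv:2205.08800 — 5 statements merged into one kernel-verified Lean document; each statement's English description precedes it below -/
import Mathlib

section
/- Fix N ≥ 1 and a link pattern β ∈ LP_N. The function F_β is smooth on 𝔛_{2N} and satisfies, for every j ∈ {1,…,2N}, the BPZ partial differential equation with κ = 16/3 (so κ/2 = 8/3 and 2h(κ) = 1/8): (8/3)·∂²F_β/∂x_j²(x) + ∑_{i≠j} [ (2/(x_i−x_j))·∂F_β/∂x_i(x) − (1/8)·F_β(x)/(x_i−x_j)² ] = 0 for all x = (x_1,…,x_{2N}) ∈ 𝔛_{2N}. -/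
open Filter Topology

noncomputable section

/-- The cross-ratio `χ(y₁,y₂,y₃,y₄)` of four reals. -/
def crossRatioR (y₁ y₂ y₃ y₄ : ℝ) : ℝ :=
  (|y₂ - y₁| * |y₄ - y₃|) / (|y₃ - y₁| * |y₄ - y₂|)

/-- The sign `±1` associated to a boolean. -/
def sgn (s : Bool) : ℝ := if s then 1 else -1

/-- `a b : Fin N → Fin (2*N)` encode a planar link pattern `β ∈ LP_N`:
the pairs (links) `{a r, b r}` partition `{0, …, 2N-1}`, the link endpoints
are ordered so that `a` is strictly increasing and `a r < b r` for every link,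
and the links are non-crossing. -/
def IsLinkPattern (N : ℕ) (a b : Fin N → Fin (2 * N)) : Prop :=
  Function.Bijective (fun p : Fin N × Bool => if p.2 then a p.1 else b p.1) ∧
    StrictMono a ∧ (∀ r, a r < b r) ∧
    ¬∃ r s : Fin N, a r < a s ∧ a s < b r ∧ b r < b s

/-- The function `F_β` associated to the link pattern `β` encoded by `a, b`. -/
def Fbeta (N : ℕ) (a b : Fin N → Fin (2 * N)) (x : Fin (2 * N) → ℝ) : ℝ :=
  (∏ r : Fin N, |x (b r) - x (a r)| ^ (-(1 / 8) : ℝ)) *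
    (∑ σ : Fin N → Bool, ∏ s : Fin N, ∏ t : Fin N,
        if s < t then
          crossRatioR (x (a s)) (x (a t)) (x (b t)) (x (b s)) ^ (sgn (σ s) * sgn (σ t) / 4)
        else 1) ^ ((1 : ℝ) / 2)

/-- The chamber `𝔛_n = {x ∈ ℝⁿ : x₀ < x₁ < ⋯ < x_{n-1}}`. -/
def chamber (n : ℕ) : Set (Fin n → ℝ) := {x | StrictMono x}

/-- Partial derivative of `F` in the `i`-th coordinate at `x`. -/
def pd (n : ℕ) (F : (Fin n → ℝ) → ℝ) (i : Fin n) (x : Fin n → ℝ) : ℝ :=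
  deriv (fun t => F (Function.update x i t)) (x i)

/-- Partial fractions for `(z - k) ∏ (z - v r) / (z - u r)`, and the value of the sum of its
residues. -/
lemma partialFraction_and_sum_residues {ι : Type*} [DecidableEq ι] (T : Finset ι) (u v : ι → ℝ)
    (k : ℝ) (hu : Set.InjOn u T) :
    (∀ z, (∀ r ∈ T, z ≠ u r) →
      (z - k) * ∏ r ∈ T, (z - v r) / (z - u r) = z + (∑ r ∈ T, (u r - v r) - k) +
        ∑ r ∈ T, (u r - v r) * (u r - k) * (∏ s ∈ T.erase r, (u r - v s) / (u r - u s)) /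
          (z - u r)) ∧
    ∑ r ∈ T, (u r - v r) * (u r - k) * (∏ s ∈ T.erase r, (u r - v s) / (u r - u s)) =
      ((∑ r ∈ T, (u r - v r) - k) ^ 2 + (∑ r ∈ T, (u r ^ 2 - v r ^ 2) - k ^ 2)) / 2 := by
  induction T using Finset.induction_on with
  | empty => exact ⟨fun z _ => by simp; ring, by simp⟩
  | insert a T ha ih =>
    obtain ⟨h1, h2⟩ := ih (hu.mono (by simp))
    have hne : ∀ r ∈ T, u a ≠ u r := fun r hr h => by
      have := hu (by simp) (by simp [hr]) h
      exact ha (this ▸ hr)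
    have hRa := h1 (u a) hne
    set R : ι → ℝ := fun r =>
      (u r - v r) * (u r - k) * (∏ s ∈ T.erase r, (u r - v s) / (u r - u s))
    have hres : ∀ r ∈ T, (u r - v r) * (u r - k) *
        (∏ s ∈ (insert a T).erase r, (u r - v s) / (u r - u s)) =
        R r * ((u r - v a) / (u r - u a)) := fun r hr => by
      have har : a ≠ r := fun h => ha (h ▸ hr)
      rw [Finset.erase_insert_of_ne har, Finset.prod_insert (by simp [ha])]
      ring
    change _ = _ + ∑ r ∈ T, R r / (u a - u r) at hRa
    constructor
    · intro z hz
      have hza : z - u a ≠ 0 := sub_ne_zero.2 (hz a (by simp))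
      have hzT : ∀ r ∈ T, z ≠ u r := fun r hr => hz r (by simp [hr])
      have hz1 : _ = _ + ∑ r ∈ T, R r / (z - u r) := h1 z hzT
      have hsum : ∑ r ∈ T, (u r - v r) * (u r - k) *
          (∏ s ∈ (insert a T).erase r, (u r - v s) / (u r - u s)) / (z - u r) =
          (z - v a) / (z - u a) * (∑ r ∈ T, R r / (z - u r)) -
            (u a - v a) / (z - u a) * (∑ r ∈ T, R r / (u a - u r)) := by
        rw [Finset.mul_sum, Finset.mul_sum, ← Finset.sum_sub_distrib]
        refine Finset.sum_congr rfl fun r hr => ?_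
        have e1 : z - u r ≠ 0 := sub_ne_zero.2 (hzT r hr)
        have e2 : u a - u r ≠ 0 := sub_ne_zero.2 (hne r hr)
        rw [hres r hr, ← neg_sub (u a) (u r)]
        field_simp
        ring
      rw [Finset.prod_insert ha, Finset.sum_insert ha, Finset.sum_insert ha, Finset.erase_insert ha,
        mul_assoc (u a - v a), hRa, mul_left_comm, hz1, hsum]
      field_simp
      ring
    · have hsum : ∑ r ∈ T, (u r - v r) * (u r - k) *
          (∏ s ∈ (insert a T).erase r, (u r - v s) / (u r - u s)) =
          ∑ r ∈ T, R r - (u a - v a) * (∑ r ∈ T, R r / (u a - u r)) := by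
        rw [Finset.mul_sum, ← Finset.sum_sub_distrib]
        refine Finset.sum_congr rfl fun r hr => ?_
        have e2 : u a - u r ≠ 0 := sub_ne_zero.2 (hne r hr)
        rw [hres r hr, ← neg_sub (u a) (u r)]
        field_simp
        ring
      rw [Finset.sum_insert ha, Finset.sum_insert ha, Finset.sum_insert ha, Finset.erase_insert ha,
        mul_assoc (u a - v a), hRa, hsum, h2]
      ring

/-- The logarithm of the Coulomb gas correlation `∏_{i < l} |x i - x l| ^ (ε i ε l / 4)`. -/
def coulombLog {n : ℕ} (ε x : Fin n → ℝ) : ℝ :=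
  1 / 8 * ∑ i, ∑ l, ε i * ε l * Real.log (x i - x l)

lemma hasDerivAt_coulombLog {n : ℕ} (ε x : Fin n → ℝ) (hx : Function.Injective x) (m : Fin n) :
    HasDerivAt (fun t => coulombLog ε (Function.update x m t))
      (1 / 4 * ∑ l, ε m * ε l / (x m - x l)) (x m) := by
  have hc : ∀ i, HasDerivAt (fun t => Function.update x m t i) ((Pi.single m 1 : Fin n → ℝ) i)
      (x m) := hasDerivAt_pi.1 (hasDerivAt_update x m (x m))
  have h : ∀ i l, HasDerivAt
      (fun t => ε i * ε l * Real.log (Function.update x m t i - Function.update x m t l))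
      (ε i * ε l * (((Pi.single m 1 : Fin n → ℝ) i - (Pi.single m 1 : Fin n → ℝ) l) /
        (x i - x l))) (x m) := fun i l => by
    rcases eq_or_ne i l with rfl | hil
    · simpa using hasDerivAt_const (x m) (0 : ℝ)
    · have := (((hc i).sub (hc l)).log (by simpa [sub_eq_zero] using fun h => hil (hx h))).const_mul
        (ε i * ε l)
      simpa using this
  have := (HasDerivAt.fun_sum (u := Finset.univ) fun i _ =>
    HasDerivAt.fun_sum (u := Finset.univ) fun l _ => h i l).const_mul (1 / 8)
  refine this.congr_deriv ?_
  have e : ∀ i l, ε i * ε l * (((Pi.single m 1 : Fin n → ℝ) i - (Pi.single m 1 : Fin n → ℝ) l) /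
        (x i - x l)) = (Pi.single m 1 : Fin n → ℝ) i * (ε i * ε l / (x i - x l)) +
        (Pi.single m 1 : Fin n → ℝ) l * (ε l * ε i / (x l - x i)) := fun i l => by
    rw [← neg_sub (x i) (x l), div_neg]
    ring
  simp only [e, Finset.sum_add_distrib]
  rw [Finset.sum_comm (f := fun i l => (Pi.single m 1 : Fin n → ℝ) l * (ε l * ε i / (x l - x i)))]
  simp only [← Finset.mul_sum]
  simp only [Pi.single_apply, ite_mul, one_mul, zero_mul, Finset.sum_ite_eq', Finset.mem_univ,
    if_true]
  ring

lemma isOpen_setOf_injective (n : ℕ) : IsOpen {x : Fin n → ℝ | Function.Injective x} := by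
  have : {x : Fin n → ℝ | Function.Injective x} =
      ⋂ i, ⋂ l, {x : Fin n → ℝ | i ≠ l → x i ≠ x l} := by
    ext x
    simp only [Set.mem_iInter, Set.mem_ofPred_eq, Function.Injective]
    exact ⟨fun h i l hil e => hil (h e), fun h i l e => by_contra fun hil => h i l hil e⟩
  rw [this]
  refine isOpen_iInter_of_finite fun i => isOpen_iInter_of_finite fun l => ?_
  by_cases hil : i = l
  · simp [hil]
  · simpa [hil] using isOpen_ne_fun (continuous_apply i) (continuous_apply l)

/-- The Ward-type sum of the first-order derivatives of the Coulomb gas exponent. -/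
lemma sum_inv_mul_deriv_coulombLog {n : ℕ} (ε x : Fin n → ℝ) (hε : ∀ i, ε i ^ 2 = 1)
    (hx : Function.Injective x) (j : Fin n) :
    ∑ i, 2 / (x i - x j) * (1 / 4 * ∑ l, ε i * ε l / (x i - x l)) =
      -(∑ i, ε j * ε i / (x i - x j)) ^ 2 / 4 + (∑ i, 1 / (x i - x j) ^ 2) / 4 +
        (∑ i, ε j * ε i / (x i - x j) ^ 2) / 2 := by
  have hpt : ∀ i l, ε i * ε l * ((1 / (x i - x j) - 1 / (x l - x j)) / (x i - x l)) =
      -((ε i / (x i - x j)) * (ε l / (x l - x j))) + (if i = l then 1 / (x i - x j) ^ 2 else 0) +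
        (if l = j then ε j * ε i / (x i - x j) ^ 2 else 0) +
        (if i = j then ε j * ε l / (x l - x j) ^ 2 else 0) := fun i l => by
    have hi := hε i
    rcases eq_or_ne i l with rfl | hil
    · rcases eq_or_ne i j with rfl | hij
      · simp
      · simp only [sub_self, zero_div, mul_zero, hij, if_false, if_true]
        have hne : x i - x j ≠ 0 := sub_ne_zero.2 fun h => hij (hx h)
        field_simp
        linarith
    · have h1 : x i - x l ≠ 0 := sub_ne_zero.2 fun h => hil (hx h)
      rcases eq_or_ne l j with rfl | hlj
      · simp only [hil, if_false, if_true, sub_self, div_zero, mul_zero]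
        field_simp
        ring
      · have h2 : x l - x j ≠ 0 := sub_ne_zero.2 fun h => hlj (hx h)
        rcases eq_or_ne i j with rfl | hij
        · simp only [hil, hlj, if_false, if_true, sub_self, div_zero, zero_mul]
          rw [← neg_sub (x l) (x i)]
          field_simp
          ring
        · have h3 : x i - x j ≠ 0 := sub_ne_zero.2 fun h => hij (hx h)
          simp only [hil, hlj, hij, if_false]
          field_simp
          ring
  have hsym : ∑ i, ∑ l, ε i * ε l * ((1 / (x i - x j) - 1 / (x l - x j)) / (x i - x l)) =
      2 * ∑ i, ∑ l, 1 / (x i - x j) * (ε i * ε l / (x i - x l)) := by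
    have e : ∀ i l, ε i * ε l * ((1 / (x i - x j) - 1 / (x l - x j)) / (x i - x l)) =
        1 / (x i - x j) * (ε i * ε l / (x i - x l)) +
        1 / (x l - x j) * (ε l * ε i / (x l - x i)) := fun i l => by
      rw [← neg_sub (x i) (x l), div_neg]
      ring
    simp only [e, Finset.sum_add_distrib]
    rw [Finset.sum_comm (f := fun i l => 1 / (x l - x j) * (ε l * ε i / (x l - x i)))]
    ring
  have hp : (∑ i, ε j * ε i / (x i - x j)) ^ 2 = (∑ i, ε i / (x i - x j)) ^ 2 := by
    simp only [mul_div_assoc, ← Finset.mul_sum]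
    rw [mul_pow, hε, one_mul]
  have hS : ∑ i, 2 / (x i - x j) * (1 / 4 * ∑ l, ε i * ε l / (x i - x l)) =
      1 / 2 * ∑ i, ∑ l, 1 / (x i - x j) * (ε i * ε l / (x i - x l)) := by
    simp only [← Finset.mul_sum]
    rw [Finset.mul_sum]
    exact Finset.sum_congr rfl fun i _ => by ring
  have hT := hsym
  simp only [hpt, Finset.sum_add_distrib, Finset.sum_neg_distrib, Finset.sum_ite_eq,
    Finset.sum_ite_eq', Finset.mem_univ, if_true] at hT
  rw [← Finset.sum_mul_sum, Finset.sum_comm (f := fun i l => if i = j then _ else _)] at hT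
  simp only [Finset.sum_ite_eq', Finset.mem_univ, if_true] at hT
  rw [hS, hp]
  linarith

/-- The BPZ equation for the square root of a sum of Coulomb gas correlations follows from a
quadratic identity. -/
lemma bpz_of_quadratic {n : ℕ} {κ : Type*} [Fintype κ] [Nonempty κ] (ε : κ → Fin n → ℝ)
    (hε : ∀ c i, ε c i ^ 2 = 1) (F : (Fin n → ℝ) → ℝ)
    (hF : ∀ x, Function.Injective x → F x = √(∑ c, Real.exp (coulombLog (ε c) x)))
    (j : Fin n) (x : Fin n → ℝ) (hx : Function.Injective x)
    (hQ : ∑ c, ∑ d, Real.exp (coulombLog (ε c) x) * Real.exp (coulombLog (ε d) x) *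
      (((∑ i, ε c j * ε c i / (x i - x j)) + ∑ i, ε d j * ε d i / (x i - x j)) ^ 2 +
        2 * ((∑ i, ε c j * ε c i / (x i - x j) ^ 2) + ∑ i, ε d j * ε d i / (x i - x j) ^ 2)) = 0) :
    (8 / 3 : ℝ) * pd n (pd n F j) j x + ∑ i ∈ Finset.univ.erase j,
      (2 / (x i - x j) * pd n F i x - (1 / 8 : ℝ) * F x / (x i - x j) ^ 2) = 0 := by
  have hpos : ∀ y : Fin n → ℝ, 0 < ∑ c, Real.exp (coulombLog (ε c) y) := fun y =>
    Finset.sum_pos (fun c _ => Real.exp_pos _) Finset.univ_nonempty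
  have hev : ∀ (y : Fin n → ℝ) (m : Fin n), Function.Injective y →
      ∀ᶠ t in 𝓝 (y m), Function.Injective (Function.update y m t) := fun y m hy => by
    have hc : ContinuousAt (fun t => Function.update y m t) (y m) := by fun_prop
    exact hc.eventually_mem ((isOpen_setOf_injective n).mem_nhds (by simpa using hy))
  have hexp : ∀ (y : Fin n → ℝ) (m : Fin n) (c : κ), Function.Injective y →
      HasDerivAt (fun t => Real.exp (coulombLog (ε c) (Function.update y m t)))
        (Real.exp (coulombLog (ε c) y) * (1 / 4 * ∑ l, ε c m * ε c l / (y m - y l))) (y m) :=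
    fun y m c hy => by simpa using (hasDerivAt_coulombLog (ε c) y hy m).exp
  have hsum : ∀ (y : Fin n → ℝ) (m : Fin n), Function.Injective y →
      HasDerivAt (fun t => ∑ c, Real.exp (coulombLog (ε c) (Function.update y m t)))
        (∑ c, Real.exp (coulombLog (ε c) y) * (1 / 4 * ∑ l, ε c m * ε c l / (y m - y l))) (y m) :=
    fun y m hy => HasDerivAt.fun_sum fun c _ => hexp y m c hy
  have hsqrt : ∀ (y : Fin n → ℝ) (m : Fin n), Function.Injective y →
      HasDerivAt (fun t => √(∑ c, Real.exp (coulombLog (ε c) (Function.update y m t))))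
        ((∑ c, Real.exp (coulombLog (ε c) y) * (1 / 4 * ∑ l, ε c m * ε c l / (y m - y l))) /
          (2 * √(∑ c, Real.exp (coulombLog (ε c) y)))) (y m) := fun y m hy => by
    simpa using (hsum y m hy).sqrt (by simpa using (hpos y).ne')
  have hpd : ∀ (y : Fin n → ℝ) (m : Fin n), Function.Injective y → pd n F m y =
      (∑ c, Real.exp (coulombLog (ε c) y) * (1 / 4 * ∑ l, ε c m * ε c l / (y m - y l))) /
        (2 * √(∑ c, Real.exp (coulombLog (ε c) y))) := fun y m hy =>
    ((hsqrt y m hy).congr_of_eventuallyEq ((hev y m hy).mono fun t ht => hF _ ht)).deriv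
  -- second derivative in the direction `j`
  have hinner : ∀ c, HasDerivAt (fun t => 1 / 4 * ∑ l, ε c j * ε c l /
      (Function.update x j t j - Function.update x j t l))
      (-(1 / 4 * ∑ l, ε c j * ε c l / (x l - x j) ^ 2)) (x j) := fun c => by
    have h1 : ∀ l, HasDerivAt (fun t => ε c j * ε c l /
        (Function.update x j t j - Function.update x j t l))
        (-(ε c j * ε c l / (x l - x j) ^ 2)) (x j) := fun l => by
      rcases eq_or_ne l j with rfl | hl
      · simpa using hasDerivAt_const (x l) (0 : ℝ)
      · have hne : x j - x l ≠ 0 := sub_ne_zero.2 fun h => hl (hx h).symm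
        simp only [Function.update_self, Function.update_of_ne hl]
        refine (((hasDerivAt_id (x j)).sub_const (x l)).fun_inv hne |>.const_mul
          (ε c j * ε c l)).congr_deriv ?_
        simp only [id]
        rw [← neg_sub (x l) (x j), neg_sq]
        ring
    refine ((HasDerivAt.fun_sum (u := Finset.univ) fun l _ => h1 l).const_mul
      (1 / 4)).congr_deriv ?_
    simp [Finset.sum_neg_distrib]
  set w : κ → ℝ := fun c => Real.exp (coulombLog (ε c) x) with hw
  set p : κ → ℝ := fun c => ∑ i, ε c j * ε c i / (x i - x j) with hp
  set q : κ → ℝ := fun c => ∑ i, ε c j * ε c i / (x i - x j) ^ 2 with hq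
  set S := ∑ i, 1 / (x i - x j) ^ 2 with hS
  have hp' : ∀ c, 1 / 4 * ∑ l, ε c j * ε c l / (x j - x l) = -(p c / 4) := fun c => by
    have : ∀ l, ε c j * ε c l / (x j - x l) = -(ε c j * ε c l / (x l - x j)) := fun l => by
      rw [← neg_sub (x l) (x j), div_neg]
    simp only [this, Finset.sum_neg_distrib, hp]
    ring
  have hnum := HasDerivAt.fun_sum (u := Finset.univ) fun c (_ : c ∈ Finset.univ) =>
    (hexp x j c hx).fun_mul (hinner c)
  have hsecond := hnum.fun_div ((hsqrt x j hx).const_mul 2)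
    (by simpa using (Real.sqrt_pos.2 (hpos x)).ne')
  have hpd2 := (hsecond.congr_of_eventuallyEq (f₁ := fun t => pd n F j (Function.update x j t))
    ((hev x j hx).mono fun t ht => hpd _ j ht)).deriv
  simp only [Function.update_eq_self, hp'] at hpd2
  have hfirst : ∑ i ∈ Finset.univ.erase j,
      (2 / (x i - x j) * pd n F i x - (1 / 8 : ℝ) * F x / (x i - x j) ^ 2) =
      (∑ c, w c * (-(p c) ^ 2 / 4 + S / 4 + q c / 2)) / (2 * √(∑ c, w c)) -
        1 / 8 * √(∑ c, w c) * S := by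
    rw [Finset.sum_erase _ (by simp), Finset.sum_sub_distrib, hF x hx]
    congr 1
    · simp only [hpd x _ hx, hp, hq, hS, ← sum_inv_mul_deriv_coulombLog (ε _) x (hε _) hx j]
      simp only [← mul_div_assoc, ← Finset.sum_div, Finset.mul_sum]
      congr 1
      rw [Finset.sum_comm]
      exact Finset.sum_congr rfl fun c _ => Finset.sum_congr rfl fun i _ =>
        Finset.sum_congr rfl fun l _ => by ring
    · rw [hS, Finset.mul_sum]
      exact Finset.sum_congr rfl fun i _ => by ring
  rw [hfirst]
  change (8 / 3 : ℝ) * deriv (fun t => pd n F j (Function.update x j t)) (x j) + _ = 0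
  rw [hpd2]
  have hf : 0 < √(∑ c, w c) := Real.sqrt_pos.2 (hpos x)
  have hf2 : √(∑ c, w c) ^ 2 = ∑ c, w c := Real.sq_sqrt (hpos x).le
  set f := √(∑ c, w c)
  set P1 := ∑ c, w c * p c with hP1
  set P2 := ∑ c, w c * p c ^ 2 with hP2
  set Q1 := ∑ c, w c * q c with hQ1
  have hQ' : f ^ 2 * P2 + P1 ^ 2 + 2 * f ^ 2 * Q1 = 0 := by
    have : ∑ c, ∑ d, w c * w d * ((p c + p d) ^ 2 + 2 * (q c + q d)) =
        2 * ((∑ c, w c) * P2 + P1 ^ 2 + 2 * (∑ c, w c) * Q1) := by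
      have e : ∀ c d, w c * w d * ((p c + p d) ^ 2 + 2 * (q c + q d)) =
          (w c * p c ^ 2) * w d + w c * (w d * p d ^ 2) + 2 * ((w c * p c) * (w d * p d)) +
          2 * ((w c * q c) * w d) + 2 * (w c * (w d * q d)) := fun c d => by ring
      simp only [e, Finset.sum_add_distrib, ← Finset.mul_sum, ← Finset.sum_mul]
      ring
    rw [hf2]
    linarith
  have g1 : ∑ c, w c * -(p c / 4) = -P1 / 4 := by
    rw [hP1, neg_div, Finset.sum_div, ← Finset.sum_neg_distrib]
    exact Finset.sum_congr rfl fun c _ => by ring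
  have g2 : ∑ c, (w c * -(p c / 4) * -(p c / 4) +
      w c * -(1 / 4 * ∑ l, ε c j * ε c l / (x l - x j) ^ 2)) = P2 / 16 - Q1 / 4 := by
    rw [hP2, hQ1, Finset.sum_div, Finset.sum_div, ← Finset.sum_sub_distrib]
    exact Finset.sum_congr rfl fun c _ => by simp only [hq]; ring
  have g3 : ∑ c, w c * (-(p c) ^ 2 / 4 + S / 4 + q c / 2) = -P2 / 4 + f ^ 2 * S / 4 + Q1 / 2 := by
    have e : ∀ c, w c * (-(p c) ^ 2 / 4 + S / 4 + q c / 2) =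
        -1 / 4 * (w c * p c ^ 2) + S / 4 * w c + 1 / 2 * (w c * q c) := fun c => by ring
    simp only [e, Finset.sum_add_distrib, ← Finset.mul_sum]
    rw [hf2]
    ring
  rw [g1, g2, g3]
  field_simp
  linear_combination (-1024 : ℝ) * hQ'

section Links

variable {ι : Type*} {n : ℕ}

lemma sgn_mul_self (c : Bool) : sgn c * sgn c = 1 := by cases c <;> simp [sgn]

lemma sgn_not (c : Bool) : sgn (!c) = -sgn c := by cases c <;> simp [sgn]

/-- The charges attached to the endpoints of the links: the endpoint `e (s, c)` of the link `s` has
charge `+1` if `σ s = c` and `-1` otherwise. -/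
def linkCharge (e : ι × Bool ≃ Fin n) (σ : ι → Bool) (i : Fin n) : ℝ :=
  sgn (σ (e.symm i).1) * sgn (e.symm i).2

lemma linkCharge_apply (e : ι × Bool ≃ Fin n) (σ : ι → Bool) (s : ι) (c : Bool) :
    linkCharge e σ (e (s, c)) = sgn (σ s) * sgn c := by
  simp [linkCharge]

lemma linkCharge_sq (e : ι × Bool ≃ Fin n) (σ : ι → Bool) (i : Fin n) :
    linkCharge e σ i ^ 2 = 1 := by
  rw [linkCharge, mul_pow, pow_two, pow_two, sgn_mul_self, sgn_mul_self, one_mul]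

lemma sum_eq_sum_links [Fintype ι] (e : ι × Bool ≃ Fin n) (g : Fin n → ℝ) :
    ∑ i, g i = ∑ s, (g (e (s, true)) + g (e (s, false))) := by
  rw [← e.sum_comp, Fintype.sum_prod_type]
  simp

/-- The logarithm of the cross-ratio of the endpoints of two links. -/
def linkLog (e : ι × Bool ≃ Fin n) (x : Fin n → ℝ) (s t : ι) : ℝ :=
  Real.log (x (e (s, true)) - x (e (t, true))) + Real.log (x (e (s, false)) - x (e (t, false))) -
    Real.log (x (e (s, true)) - x (e (t, false))) - Real.log (x (e (s, false)) - x (e (t, true)))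

lemma log_sub_comm (y z : ℝ) : Real.log (y - z) = Real.log (z - y) := by
  rw [← neg_sub, Real.log_neg_eq_log]

lemma linkLog_comm (e : ι × Bool ≃ Fin n) (x : Fin n → ℝ) (s t : ι) :
    linkLog e x s t = linkLog e x t s := by
  unfold linkLog
  rw [log_sub_comm (x (e (s, true))), log_sub_comm (x (e (s, false))),
    log_sub_comm (x (e (s, true))), log_sub_comm (x (e (s, false)))]
  ring

lemma coulombLog_linkCharge [Fintype ι] (e : ι × Bool ≃ Fin n) (x : Fin n → ℝ) (σ : ι → Bool) :
    coulombLog (linkCharge e σ) x =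
      1 / 8 * ∑ s, ∑ t, sgn (σ s) * sgn (σ t) * linkLog e x s t := by
  unfold coulombLog
  rw [sum_eq_sum_links e]
  simp only [sum_eq_sum_links e (fun l => _ * linkCharge e σ l * _), ← Finset.sum_add_distrib]
  congr 1
  refine Finset.sum_congr rfl fun s _ => Finset.sum_congr rfl fun t _ => ?_
  simp only [linkCharge_apply, linkLog, sgn, if_true, Bool.false_eq_true, if_false]
  ring

/-- Reversal of the charges of the link `r`. -/
def flipLink [DecidableEq ι] (r : ι) (σ : ι → Bool) : ι → Bool := Function.update σ r (!σ r)

lemma flipLink_self [DecidableEq ι] (r : ι)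
    (σ : ι → Bool) : flipLink r σ r = !σ r := by simp [flipLink]

lemma flipLink_of_ne [DecidableEq ι] {r s : ι} (h : s ≠ r)
    (σ : ι → Bool) : flipLink r σ s = σ s := by
  simp [flipLink, h]

lemma flipLink_involutive [DecidableEq ι] (r : ι) : Function.Involutive (flipLink r) := fun σ => by
  simp [flipLink]

lemma coulombLog_sub_flipLink [Fintype ι] [DecidableEq ι] (e : ι × Bool ≃ Fin n) (x : Fin n → ℝ)
    (σ : ι → Bool) (r : ι) :
    coulombLog (linkCharge e σ) x - coulombLog (linkCharge e (flipLink r σ)) x =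
      1 / 2 * ∑ t ∈ Finset.univ.erase r, sgn (σ r) * sgn (σ t) * linkLog e x r t := by
  have hpt : ∀ s t, sgn (σ s) * sgn (σ t) * linkLog e x s t -
      sgn (flipLink r σ s) * sgn (flipLink r σ t) * linkLog e x s t =
      (if s = r then 2 * (sgn (σ r) * sgn (σ t) * linkLog e x r t) else 0) +
      (if t = r then 2 * (sgn (σ r) * sgn (σ s) * linkLog e x r s) else 0) -
      (if s = r then (if t = r then 4 * (sgn (σ r) * sgn (σ r) * linkLog e x r r) else 0)
        else 0) := by
    intro s t
    by_cases hs : s = r <;> by_cases ht : t = r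
    · subst hs; subst ht; simp only [flipLink_self, sgn_not, if_true]; ring
    · subst hs; simp only [flipLink_self, flipLink_of_ne ht, sgn_not, if_true, ht, if_false]; ring
    · subst ht
      simp only [flipLink_self, flipLink_of_ne hs, sgn_not, if_true, hs, if_false,
        linkLog_comm e x s t]
      ring
    · simp only [flipLink_of_ne hs, flipLink_of_ne ht, hs, ht, if_false]; ring
  rw [coulombLog_linkCharge, coulombLog_linkCharge, ← mul_sub, ← Finset.sum_sub_distrib]
  simp only [← Finset.sum_sub_distrib, hpt]
  simp only [Finset.sum_sub_distrib, Finset.sum_add_distrib]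
  rw [Finset.sum_comm (f := fun s t => if s = r then 2 * _ else 0),
    Finset.sum_comm (f := fun s t => if s = r then (if t = r then _ else _) else 0)]
  simp only [Finset.sum_ite_eq', Finset.mem_univ, if_true, ← Finset.mul_sum]
  rw [← Finset.add_sum_erase _ _ (Finset.mem_univ r)]
  ring

/-- The oriented cross-ratio of the links `r` and `t`. -/
def linkRatio (e : ι × Bool ≃ Fin n) (y : Fin n → ℝ) (σ : ι → Bool) (r t : ι) : ℝ :=
  ((y (e (r, σ r)) - y (e (t, σ t))) * (y (e (r, !σ r)) - y (e (t, !σ t)))) /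
    ((y (e (r, σ r)) - y (e (t, !σ t))) * (y (e (r, !σ r)) - y (e (t, σ t))))

/-- The links `r` and `t` do not cross in the configuration `x`. -/
def LinksDisjoint (e : ι × Bool ≃ Fin n) (x : Fin n → ℝ) (r t : ι) : Prop :=
  0 < (x (e (r, true)) - x (e (t, true))) * (x (e (r, false)) - x (e (t, false))) *
    ((x (e (r, true)) - x (e (t, false))) * (x (e (r, false)) - x (e (t, true))))

lemma sub_endpoint_ne_zero (e : ι × Bool ≃ Fin n) {x : Fin n → ℝ} (hx : Function.Injective x)
    {r t : ι} (h : r ≠ t) (c d : Bool) : x (e (r, c)) - x (e (t, d)) ≠ 0 :=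
  sub_ne_zero.2 fun H => h (by simpa using congrArg Prod.fst (e.injective (hx H)))

lemma linkRatio_pos (e : ι × Bool ≃ Fin n) (x : Fin n → ℝ) (σ : ι → Bool) {r t : ι}
    (h : LinksDisjoint e x r t) : 0 < linkRatio e x σ r t := by
  unfold LinksDisjoint at h
  have h' : 0 < ((x (e (r, σ r)) - x (e (t, σ t))) * (x (e (r, !σ r)) - x (e (t, !σ t)))) *
    ((x (e (r, σ r)) - x (e (t, !σ t))) * (x (e (r, !σ r)) - x (e (t, σ t)))) := by
    cases σ r <;> cases σ t <;> simp only [Bool.not_true, Bool.not_false] <;> linarith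
  unfold linkRatio
  rcases pos_and_pos_or_neg_and_neg_of_mul_pos h' with ⟨h1, h2⟩ | ⟨h1, h2⟩
  · exact div_pos h1 h2
  · exact div_pos_of_neg_of_neg h1 h2

lemma log_linkRatio (e : ι × Bool ≃ Fin n) {x : Fin n → ℝ} (hx : Function.Injective x)
    (σ : ι → Bool) {r t : ι} (h : r ≠ t) :
    Real.log (linkRatio e x σ r t) = sgn (σ r) * sgn (σ t) * linkLog e x r t := by
  have hne := sub_endpoint_ne_zero e hx h
  unfold linkRatio linkLog
  rw [Real.log_div (mul_ne_zero (hne _ _) (hne _ _)) (mul_ne_zero (hne _ _) (hne _ _)),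
    Real.log_mul (hne _ _) (hne _ _), Real.log_mul (hne _ _) (hne _ _)]
  cases σ r <;> cases σ t <;> simp only [Bool.not_true, Bool.not_false, sgn, if_true,
    Bool.false_eq_true, if_false] <;> ring

lemma exp_mul_exp_eq_flipLink [Fintype ι] [DecidableEq ι] (e : ι × Bool ≃ Fin n)
    {x : Fin n → ℝ} (hx : Function.Injective x)
    (hnc : ∀ r t, r ≠ t → LinksDisjoint e x r t) (σ τ : ι → Bool) {r : ι} (hr : σ r = τ r) :
    Real.exp (coulombLog (linkCharge e σ) x) * Real.exp (coulombLog (linkCharge e τ) x) =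
      Real.exp (coulombLog (linkCharge e (flipLink r σ)) x) *
        Real.exp (coulombLog (linkCharge e (flipLink r τ)) x) *
          ∏ t ∈ (Finset.univ.filter fun s => σ s = τ s).erase r, linkRatio e x σ r t := by
  have hX : ∏ t ∈ (Finset.univ.filter fun s => σ s = τ s).erase r, linkRatio e x σ r t =
      Real.exp (∑ t ∈ (Finset.univ.filter fun s => σ s = τ s).erase r,
        sgn (σ r) * sgn (σ t) * linkLog e x r t) := by
    rw [Real.exp_sum]
    refine Finset.prod_congr rfl fun t ht => ?_
    have hrt : r ≠ t := (Finset.ne_of_mem_erase ht).symm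
    rw [← log_linkRatio e hx σ hrt, Real.exp_log (linkRatio_pos e x σ (hnc r t hrt))]
  have hS : ∑ t ∈ (Finset.univ.filter fun s => σ s = τ s).erase r,
      sgn (σ r) * sgn (σ t) * linkLog e x r t =
      1 / 2 * ∑ t ∈ Finset.univ.erase r, sgn (σ r) * sgn (σ t) * linkLog e x r t +
      1 / 2 * ∑ t ∈ Finset.univ.erase r, sgn (τ r) * sgn (τ t) * linkLog e x r t := by
    rw [← Finset.filter_erase, Finset.sum_filter, Finset.mul_sum, Finset.mul_sum,
      ← Finset.sum_add_distrib]
    refine Finset.sum_congr rfl fun t _ => ?_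
    rw [← hr]
    split_ifs with h
    · rw [h]; ring
    · rw [Bool.eq_not_of_ne h, sgn_not]; ring
  rw [hX, ← Real.exp_add, ← Real.exp_add, ← Real.exp_add, hS, ← coulombLog_sub_flipLink,
    ← coulombLog_sub_flipLink]
  congr 1
  ring

/-- The residue attached to the link `r` in the coordinates `y`, where `r₀` is the link whose
endpoint has been sent to infinity, its other endpoint being `k`. -/
def linkResidue [Fintype ι] [DecidableEq ι] (e : ι × Bool ≃ Fin n) (y : Fin n → ℝ)
    (k : ℝ) (r₀ : ι) (σ τ : ι → Bool)
    (r : ι) : ℝ :=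
  (y (e (r, σ r)) - y (e (r, !σ r))) * (y (e (r, σ r)) - k) *
    ∏ s ∈ ((Finset.univ.filter fun s => σ s = τ s).erase r₀).erase r,
      (y (e (r, σ r)) - y (e (s, !σ s))) / (y (e (r, σ r)) - y (e (s, σ s)))

lemma filter_flipLink [Fintype ι] [DecidableEq ι] (σ τ : ι → Bool) (r : ι) :
    (Finset.univ.filter fun s => flipLink r σ s = flipLink r τ s) =
      Finset.univ.filter fun s => σ s = τ s := by
  ext s
  rcases eq_or_ne s r with rfl | h
  · simp [flipLink_self]
  · simp [flipLink_of_ne h]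

lemma inv_sub_inv_sub {a b c : ℝ} (ha : a - c ≠ 0) (hb : b - c ≠ 0) :
    1 / (a - c) - 1 / (b - c) = -(a - b) / ((a - c) * (b - c)) := by
  field_simp
  ring

/-- The residue at a link changes sign when the link is reversed. -/
lemma linkResidue_flipLink [Fintype ι] [DecidableEq ι] (e : ι × Bool ≃ Fin n)
    {x : Fin n → ℝ} (hx : Function.Injective x)
    (hnc : ∀ r t, r ≠ t → LinksDisjoint e x r t) (σ τ : ι → Bool) {r r₀ : ι} (hr : σ r = τ r)
    (hrr₀ : r ≠ r₀) (hr₀ : σ r₀ = τ r₀) :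
    Real.exp (coulombLog (linkCharge e σ) x) * Real.exp (coulombLog (linkCharge e τ) x) *
      linkResidue e (fun i => 1 / (x i - x (e (r₀, σ r₀))))
        (1 / (x (e (r₀, !σ r₀)) - x (e (r₀, σ r₀)))) r₀ σ τ r =
    -(Real.exp (coulombLog (linkCharge e (flipLink r σ)) x) *
      Real.exp (coulombLog (linkCharge e (flipLink r τ)) x) *
      linkResidue e (fun i => 1 / (x i - x (e (r₀, σ r₀))))
        (1 / (x (e (r₀, !σ r₀)) - x (e (r₀, σ r₀)))) r₀ (flipLink r σ) (flipLink r τ) r) := by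
  set j := e (r₀, σ r₀) with hj
  have hk : x (e (r₀, !σ r₀)) - x j ≠ 0 := sub_ne_zero.2 fun H => by
    simpa using congrArg Prod.snd (e.injective (hx H))
  have hu : ∀ s c, s ≠ r₀ → x (e (s, c)) - x j ≠ 0 := fun s c hs =>
    sub_endpoint_ne_zero e hx hs c _
  have hmem : r₀ ∈ (Finset.univ.filter fun s => σ s = τ s).erase r := by
    simp [hr₀, hrr₀.symm]
  rw [exp_mul_exp_eq_flipLink e hx hnc σ τ hr, ← Finset.mul_prod_erase _ _ hmem,
    Finset.erase_right_comm]
  unfold linkResidue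
  rw [filter_flipLink, flipLink_self, Bool.not_not]
  set B := ((Finset.univ.filter fun s => σ s = τ s).erase r₀).erase r
  have hprod : ∏ s ∈ B, ((1 / (x (e (r, !σ r)) - x j) - 1 / (x (e (s, !flipLink r σ s)) - x j)) /
      (1 / (x (e (r, !σ r)) - x j) - 1 / (x (e (s, flipLink r σ s)) - x j))) =
      (∏ s ∈ B, linkRatio e x σ r s) *
        ∏ s ∈ B, ((1 / (x (e (r, σ r)) - x j) - 1 / (x (e (s, !σ s)) - x j)) /
      (1 / (x (e (r, σ r)) - x j) - 1 / (x (e (s, σ s)) - x j))) := by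
    rw [← Finset.prod_mul_distrib]
    refine Finset.prod_congr rfl fun s hs => ?_
    have hsr : s ≠ r := Finset.ne_of_mem_erase hs
    have hsr₀ : s ≠ r₀ := Finset.ne_of_mem_erase (Finset.mem_of_mem_erase hs)
    have hrs := sub_endpoint_ne_zero e hx hsr.symm
    rw [flipLink_of_ne hsr, inv_sub_inv_sub (hu _ _ hrr₀) (hu _ _ hsr₀),
      inv_sub_inv_sub (hu _ _ hrr₀) (hu _ _ hsr₀), inv_sub_inv_sub (hu _ _ hrr₀) (hu _ _ hsr₀),
      inv_sub_inv_sub (hu _ _ hrr₀) (hu _ _ hsr₀), linkRatio]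
    have h1 := hrs (σ r) (σ s)
    have h2 := hrs (!σ r) (σ s)
    have h3 := hrs (σ r) (!σ s)
    have h4 := hrs (!σ r) (!σ s)
    have h5 := hu r (σ r) hrr₀
    have h6 := hu r (!σ r) hrr₀
    have h7 := hu s (σ s) hsr₀
    have h8 := hu s (!σ s) hsr₀
    field_simp
  have hratio : 1 / (x (e (r, !σ r)) - x j) - 1 / (x (e (r₀, !σ r₀)) - x j) =
      linkRatio e x σ r r₀ *
        (1 / (x (e (r, σ r)) - x j) - 1 / (x (e (r₀, !σ r₀)) - x j)) := by
    rw [inv_sub_inv_sub (hu _ _ hrr₀) hk, inv_sub_inv_sub (hu _ _ hrr₀) hk, linkRatio, ← hj]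
    have h3 := sub_endpoint_ne_zero e hx hrr₀ (σ r) (!σ r₀)
    have h5 := hu r (σ r) hrr₀
    have h6 := hu r (!σ r) hrr₀
    field_simp
  rw [hprod, hratio]
  ring

/-- The quadratic form of the BPZ equation is a sum of residues. -/
lemma quadratic_eq_sum_linkResidue [Fintype ι] [DecidableEq ι] (e : ι × Bool ≃ Fin n)
    {x : Fin n → ℝ} (hx : Function.Injective x) (σ τ : ι → Bool) {r₀ : ι} (hr₀ : σ r₀ = τ r₀) :
    ((∑ i, linkCharge e σ (e (r₀, σ r₀)) * linkCharge e σ i / (x i - x (e (r₀, σ r₀)))) +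
      ∑ i, linkCharge e τ (e (r₀, σ r₀)) * linkCharge e τ i / (x i - x (e (r₀, σ r₀)))) ^ 2 +
    2 * ((∑ i, linkCharge e σ (e (r₀, σ r₀)) * linkCharge e σ i / (x i - x (e (r₀, σ r₀))) ^ 2) +
      ∑ i, linkCharge e τ (e (r₀, σ r₀)) * linkCharge e τ i / (x i - x (e (r₀, σ r₀))) ^ 2) =
    8 * ∑ r ∈ (Finset.univ.filter fun s => σ s = τ s).erase r₀,
      linkResidue e (fun i => 1 / (x i - x (e (r₀, σ r₀))))
        (1 / (x (e (r₀, !σ r₀)) - x (e (r₀, σ r₀)))) r₀ σ τ r := by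
  set j := e (r₀, σ r₀) with hj
  have hgen : ∀ g : Fin n → ℝ, g j = 0 →
      (∑ i, linkCharge e σ j * linkCharge e σ i * g i) +
        ∑ i, linkCharge e τ j * linkCharge e τ i * g i =
      2 * (∑ r ∈ (Finset.univ.filter fun s => σ s = τ s).erase r₀,
        (g (e (r, σ r)) - g (e (r, !σ r))) - g (e (r₀, !σ r₀))) := fun g hg => by
    have hmem : r₀ ∈ (Finset.univ.filter fun s => σ s = τ s) := by simp [hr₀]
    have h1 := Finset.add_sum_erase _ (fun r => g (e (r, σ r)) - g (e (r, !σ r))) hmem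
    simp only [← hj, hg] at h1
    have h2 : ∑ r ∈ (Finset.univ.filter fun s => σ s = τ s).erase r₀,
        (g (e (r, σ r)) - g (e (r, !σ r))) - g (e (r₀, !σ r₀)) =
        ∑ r ∈ (Finset.univ.filter fun s => σ s = τ s), (g (e (r, σ r)) - g (e (r, !σ r))) := by
      linarith
    rw [h2, sum_eq_sum_links e, sum_eq_sum_links e, ← Finset.sum_add_distrib, Finset.sum_filter,
      Finset.mul_sum]
    refine Finset.sum_congr rfl fun s _ => ?_
    simp only [hj, linkCharge_apply, ← hr₀, sgn_mul_self]
    split_ifs with h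
    · rw [← h]
      cases σ s <;> simp [sgn] <;> ring
    · rw [Bool.eq_not_of_ne h, sgn_not]
      ring
  have hinj : Set.InjOn (fun r => 1 / (x (e (r, σ r)) - x j))
      ((Finset.univ.filter fun s => σ s = τ s).erase r₀ : Finset ι) := fun s _ t _ h => by
    simp only [one_div, inv_inj, sub_left_inj] at h
    simpa using congrArg Prod.fst (e.injective (hx h))
  have hres := (partialFraction_and_sum_residues _ (fun r => 1 / (x (e (r, σ r)) - x j))
    (fun r => 1 / (x (e (r, !σ r)) - x j)) (1 / (x (e (r₀, !σ r₀)) - x j)) hinj).2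
  have h1 := hgen (fun i => 1 / (x i - x j)) (by simp)
  have h2 := hgen (fun i => (1 / (x i - x j)) ^ 2) (by simp)
  unfold linkResidue
  rw [hres]
  simp only [div_pow, one_pow, mul_one_div] at h1 h2 ⊢
  rw [h1, h2]
  ring

/-- Global charge reversal so that the endpoint `e (r₀, c)` has charge `+1`. -/
def normalizeCharge (r₀ : ι) (c : Bool) (σ : ι → Bool) : ι → Bool :=
  fun s => ((σ s).xor (σ r₀)).xor c

lemma linkCharge_normalizeCharge (e : ι × Bool ≃ Fin n) (r₀ : ι) (c : Bool) (σ : ι → Bool)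
    (i : Fin n) :
    linkCharge e (normalizeCharge r₀ c σ) i = sgn (σ r₀) * sgn c * linkCharge e σ i := by
  unfold linkCharge normalizeCharge
  cases σ r₀ <;> cases c <;> cases σ (e.symm i).1 <;> simp [sgn]

lemma linkCharge_mul_normalizeCharge (e : ι × Bool ≃ Fin n) (r₀ : ι) (c : Bool) (σ : ι → Bool)
    (i l : Fin n) :
    linkCharge e (normalizeCharge r₀ c σ) i * linkCharge e (normalizeCharge r₀ c σ) l =
      linkCharge e σ i * linkCharge e σ l := by
  rw [linkCharge_normalizeCharge, linkCharge_normalizeCharge]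
  linear_combination (sgn c * sgn c * linkCharge e σ i * linkCharge e σ l) * sgn_mul_self (σ r₀) +
    (linkCharge e σ i * linkCharge e σ l) * sgn_mul_self c

lemma normalizeCharge_flipLink [DecidableEq ι] {r r₀ : ι} (h : r ≠ r₀) (c : Bool) (σ : ι → Bool) :
    normalizeCharge r₀ c (flipLink r σ) = flipLink r (normalizeCharge r₀ c σ) := by
  funext s
  rcases eq_or_ne s r with rfl | hs
  · simp [normalizeCharge, flipLink_self, flipLink_of_ne h.symm]
  · simp [normalizeCharge, flipLink_of_ne hs, flipLink_of_ne h.symm]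

/-- The quadratic identity behind the BPZ equation, for non-crossing links. -/
lemma sum_quadratic_eq_zero [Fintype ι] [DecidableEq ι] (e : ι × Bool ≃ Fin n)
    {x : Fin n → ℝ} (hx : Function.Injective x)
    (hnc : ∀ r t, r ≠ t → LinksDisjoint e x r t) (j : Fin n) :
    ∑ σ, ∑ τ, Real.exp (coulombLog (linkCharge e σ) x) * Real.exp (coulombLog (linkCharge e τ) x) *
      (((∑ i, linkCharge e σ j * linkCharge e σ i / (x i - x j)) +
          ∑ i, linkCharge e τ j * linkCharge e τ i / (x i - x j)) ^ 2 +
        2 * ((∑ i, linkCharge e σ j * linkCharge e σ i / (x i - x j) ^ 2) +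
          ∑ i, linkCharge e τ j * linkCharge e τ i / (x i - x j) ^ 2)) = 0 := by
  obtain ⟨⟨r₀, c⟩, rfl⟩ := e.surjective j
  set ν := normalizeCharge r₀ c
  set H : ι → (ι → Bool) → (ι → Bool) → ℝ := fun r σ τ => if σ r = τ r then
    Real.exp (coulombLog (linkCharge e σ) x) * Real.exp (coulombLog (linkCharge e τ) x) *
      linkResidue e (fun i => 1 / (x i - x (e (r₀, c))))
        (1 / (x (e (r₀, !c)) - x (e (r₀, c)))) r₀ σ τ r else 0 with hH
  have hν : ∀ σ, ν σ r₀ = c := fun σ => by simp [ν, normalizeCharge]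
  have hanti : ∀ r ≠ r₀, ∀ σ τ : ι → Bool, σ r₀ = c → τ r₀ = c →
      H r (flipLink r σ) (flipLink r τ) = -H r σ τ := by
    rintro r hr σ τ rfl hτ
    by_cases h : σ r = τ r
    · simp only [hH, h, flipLink_self, if_true]
      rw [linkResidue_flipLink e hx hnc σ τ h hr hτ.symm, neg_neg]
    · simp [hH, h, flipLink_self]
  have hzero : ∀ r ≠ r₀, ∑ σ, ∑ τ, H r (ν σ) (ν τ) = 0 := fun r hr => by
    have h1 : ∑ σ, ∑ τ, H r (ν σ) (ν τ) = ∑ σ, ∑ τ, H r (ν (flipLink r σ)) (ν (flipLink r τ)) := by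
      rw [← Equiv.sum_comp (flipLink_involutive r).toPerm]
      refine Finset.sum_congr rfl fun σ _ => ?_
      rw [← Equiv.sum_comp (flipLink_involutive r).toPerm]
      rfl
    have h2 : ∀ σ τ, H r (ν (flipLink r σ)) (ν (flipLink r τ)) = -H r (ν σ) (ν τ) := fun σ τ => by
      simp only [ν]
      rw [normalizeCharge_flipLink hr, normalizeCharge_flipLink hr]
      exact hanti r hr _ _ (hν σ) (hν τ)
    simp only [h2, Finset.sum_neg_distrib] at h1
    linarith
  have hterm : ∀ σ τ : ι → Bool,
      Real.exp (coulombLog (linkCharge e σ) x) * Real.exp (coulombLog (linkCharge e τ) x) *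
      (((∑ i, linkCharge e σ (e (r₀, c)) * linkCharge e σ i / (x i - x (e (r₀, c)))) +
          ∑ i, linkCharge e τ (e (r₀, c)) * linkCharge e τ i / (x i - x (e (r₀, c)))) ^ 2 +
        2 * ((∑ i, linkCharge e σ (e (r₀, c)) * linkCharge e σ i / (x i - x (e (r₀, c))) ^ 2) +
          ∑ i, linkCharge e τ (e (r₀, c)) * linkCharge e τ i / (x i - x (e (r₀, c))) ^ 2)) =
      8 * ∑ r ∈ Finset.univ.erase r₀, H r (ν σ) (ν τ) := fun σ τ => by
    have h := quadratic_eq_sum_linkResidue e hx (ν σ) (ν τ) (r₀ := r₀) (by rw [hν, hν])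
    have hc : ∀ σ, coulombLog (linkCharge e (ν σ)) x = coulombLog (linkCharge e σ) x := fun σ => by
      simp only [coulombLog, ν, linkCharge_mul_normalizeCharge]
    rw [hν] at h
    simp only [ν, linkCharge_mul_normalizeCharge] at h
    rw [h]
    simp only [hH, hc]
    rw [← Finset.sum_filter, Finset.filter_erase, ← Finset.mul_sum]
    simp only [ν]
    ring
  simp only [hterm, ← Finset.mul_sum]
  rw [Finset.sum_congr rfl fun σ _ => Finset.sum_comm, Finset.sum_comm,
    Finset.sum_eq_zero fun r hr => hzero r (Finset.ne_of_mem_erase hr), mul_zero]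

end Links

/-- The endpoints of the links of a link pattern, as an equivalence. -/
def linkEquiv {N : ℕ} {a b : Fin N → Fin (2 * N)} (hβ : IsLinkPattern N a b) :
    Fin N × Bool ≃ Fin (2 * N) :=
  Equiv.ofBijective _ hβ.1

lemma linkEquiv_true {N : ℕ} {a b : Fin N → Fin (2 * N)} (hβ : IsLinkPattern N a b) (r : Fin N) :
    linkEquiv hβ (r, true) = a r := rfl

lemma linkEquiv_false {N : ℕ} {a b : Fin N → Fin (2 * N)} (hβ : IsLinkPattern N a b)
    (r : Fin N) : linkEquiv hβ (r, false) = b r := rfl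

lemma linksDisjoint_linkEquiv {N : ℕ} {a b : Fin N → Fin (2 * N)} (hβ : IsLinkPattern N a b)
    {x : Fin (2 * N) → ℝ} (hx : StrictMono x) (r t : Fin N) (hrt : r ≠ t) :
    LinksDisjoint (linkEquiv hβ) x r t := by
  wlog h : r < t generalizing r t
  · have := this t r hrt.symm (lt_of_le_of_ne (not_lt.1 h) hrt.symm)
    unfold LinksDisjoint at this ⊢
    linarith
  have hne : b r ≠ a t := fun H => by
    simpa using congrArg Prod.snd ((linkEquiv hβ).injective
      (show linkEquiv hβ (r, false) = linkEquiv hβ (t, true) from H))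
  have hne' : b r ≠ b t := fun H => hrt <| by
    simpa using congrArg Prod.fst ((linkEquiv hβ).injective
      (show linkEquiv hβ (r, false) = linkEquiv hβ (t, false) from H))
  have haa := hβ.2.1 h
  have h1 := hx haa
  have h2 := hx (hβ.2.2.1 t)
  unfold LinksDisjoint
  simp only [linkEquiv_true, linkEquiv_false]
  rcases lt_or_gt_of_ne hne with h3 | h3
  · have h3' := hx h3
    exact mul_pos (mul_pos_of_neg_of_neg (by linarith) (by linarith))
      (mul_pos_of_neg_of_neg (by linarith) (by linarith))
  · have h4 : b t < b r := lt_of_le_of_ne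
      (not_lt.1 fun H => hβ.2.2.2 ⟨r, t, haa, h3, H⟩) hne'.symm
    have h3' := hx h3
    have h4' := hx h4
    exact mul_pos_of_neg_of_neg (mul_neg_of_neg_of_pos (by linarith) (by linarith))
      (mul_neg_of_neg_of_pos (by linarith) (by linarith))

lemma crossRatioR_rpow_eq_exp {N : ℕ} {a b : Fin N → Fin (2 * N)} (hβ : IsLinkPattern N a b)
    {x : Fin (2 * N) → ℝ} (hx : Function.Injective x) {s t : Fin N} (hst : s ≠ t) (c : ℝ) :
    crossRatioR (x (a s)) (x (a t)) (x (b t)) (x (b s)) ^ c =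
      Real.exp (c * linkLog (linkEquiv hβ) x s t) := by
  have hne := sub_endpoint_ne_zero (linkEquiv hβ) hx hst
  have hne' := sub_endpoint_ne_zero (linkEquiv hβ) hx hst.symm
  have h1 : x (a t) - x (a s) ≠ 0 := hne' true true
  have h2 : x (b s) - x (b t) ≠ 0 := hne false false
  have h3 : x (b t) - x (a s) ≠ 0 := hne' false true
  have h4 : x (b s) - x (a t) ≠ 0 := hne false true
  have hpos : 0 < crossRatioR (x (a s)) (x (a t)) (x (b t)) (x (b s)) := by
    unfold crossRatioR
    positivity
  rw [Real.rpow_def_of_pos hpos, mul_comm]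
  congr 2
  unfold crossRatioR linkLog
  simp only [linkEquiv_true, linkEquiv_false]
  rw [Real.log_div (by positivity) (by positivity), Real.log_mul (by positivity) (by positivity),
    Real.log_mul (by positivity) (by positivity), Real.log_abs, Real.log_abs, Real.log_abs,
    Real.log_abs, log_sub_comm (x (a t)), log_sub_comm (x (b t)) (x (a s))]
  ring

lemma Fbeta_eq_sqrt {N : ℕ} {a b : Fin N → Fin (2 * N)} (hβ : IsLinkPattern N a b)
    {x : Fin (2 * N) → ℝ} (hx : Function.Injective x) :
    Fbeta N a b x = √(∑ σ, Real.exp (coulombLog (linkCharge (linkEquiv hβ) σ) x)) := by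
  set e := linkEquiv hβ
  have hA : ∏ r, |x (b r) - x (a r)| ^ (-(1 / 8) : ℝ) =
      Real.exp (∑ r, -(1 / 8) * Real.log (x (b r) - x (a r))) := by
    rw [Real.exp_sum]
    refine Finset.prod_congr rfl fun r _ => ?_
    have : x (b r) - x (a r) ≠ 0 := sub_ne_zero.2 (hx.ne (hβ.2.2.1 r).ne')
    rw [Real.rpow_def_of_pos (abs_pos.2 this), Real.log_abs, mul_comm]
  have hB : ∀ σ : Fin N → Bool, (∏ s : Fin N, ∏ t : Fin N, if s < t then
      crossRatioR (x (a s)) (x (a t)) (x (b t)) (x (b s)) ^ (sgn (σ s) * sgn (σ t) / 4) else 1) =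
      Real.exp (∑ s, ∑ t, if s < t then sgn (σ s) * sgn (σ t) / 4 * linkLog e x s t else 0) := by
    intro σ
    simp only [Real.exp_sum]
    refine Finset.prod_congr rfl fun s _ => Finset.prod_congr rfl fun t _ => ?_
    split_ifs with h
    · exact crossRatioR_rpow_eq_exp hβ hx h.ne _
    · simp
  have hΦ : ∀ σ, coulombLog (linkCharge e σ) x =
      2 * (∑ r, -(1 / 8) * Real.log (x (b r) - x (a r))) +
        ∑ s, ∑ t, if s < t then sgn (σ s) * sgn (σ t) / 4 * linkLog e x s t else 0 := fun σ => by
    have hpt : ∀ s t, 1 / 8 * (sgn (σ s) * sgn (σ t) * linkLog e x s t) =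
        (if s = t then 2 * (-(1 / 8) * Real.log (x (b s) - x (a s))) else 0) +
        1 / 2 * (if s < t then sgn (σ s) * sgn (σ t) / 4 * linkLog e x s t else 0) +
        1 / 2 * (if t < s then sgn (σ t) * sgn (σ s) / 4 * linkLog e x t s else 0) := by
      intro s t
      rcases lt_trichotomy s t with h | rfl | h
      · simp only [h, h.ne, h.not_gt, if_true, if_false]; ring
      · have : linkLog e x s s = -2 * Real.log (x (b s) - x (a s)) := by
          simp only [linkLog, e, linkEquiv_true, linkEquiv_false, sub_self, Real.log_zero,
            log_sub_comm (x (a s)) (x (b s))]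
          ring
        simp only [lt_irrefl, if_true, if_false, sgn_mul_self, this]
        ring
      · simp only [h, h.ne', h.not_gt, if_true, if_false, linkLog_comm e x s t]; ring
    rw [coulombLog_linkCharge]
    simp only [Finset.mul_sum, hpt, Finset.sum_add_distrib]
    simp only [← Finset.mul_sum]
    rw [Finset.sum_comm (f := fun s t => if t < s then _ else _)]
    simp only [Finset.sum_ite_eq, Finset.mem_univ, if_true, ← Finset.mul_sum]
    ring
  generalize ∑ r, -(1 / 8) * Real.log (x (b r) - x (a r)) = A at hA hΦ
  have hE : ∀ σ, Real.exp (coulombLog (linkCharge e σ) x) = Real.exp A * Real.exp A *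
      Real.exp (∑ s, ∑ t, if s < t then sgn (σ s) * sgn (σ t) / 4 * linkLog e x s t else 0) :=
    fun σ => by rw [hΦ, Real.exp_add, two_mul A, Real.exp_add]
  unfold Fbeta
  simp only [hB, hE]
  rw [← Finset.mul_sum, hA, ← Real.sqrt_eq_rpow, Real.sqrt_mul (by positivity),
    Real.sqrt_mul_self (Real.exp_pos _).le]

lemma contDiffOn_coulombLog {n : ℕ} (ε : Fin n → ℝ) :
    ContDiffOn ℝ (⊤ : ℕ∞) (coulombLog ε) {x | Function.Injective x} := by
  unfold coulombLog
  refine contDiffOn_const.mul (ContDiffOn.sum fun i _ => ContDiffOn.sum fun l _ => ?_)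
  rcases eq_or_ne i l with rfl | hil
  · simpa using contDiffOn_const
  · refine contDiffOn_const.mul (ContDiffOn.log (by fun_prop) fun x hx => ?_)
    exact sub_ne_zero.2 fun h => hil (hx h)

lemma contDiffOn_Fbeta {N : ℕ} {a b : Fin N → Fin (2 * N)} (hβ : IsLinkPattern N a b) :
    ContDiffOn ℝ (⊤ : ℕ∞) (Fbeta N a b) {x | Function.Injective x} :=
  ((ContDiffOn.sum fun _ _ => (contDiffOn_coulombLog _).exp).sqrt fun _ _ =>
    (Finset.sum_pos (fun _ _ => Real.exp_pos _) Finset.univ_nonempty).ne').congr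
      fun _ hx => Fbeta_eq_sqrt hβ hx

/-- `F_β` is smooth on `𝔛_{2N}` and satisfies the BPZ PDEs with `κ = 16/3`. -/
theorem Fbeta_smooth_and_BPZ (N : ℕ) (hN : 1 ≤ N) (a b : Fin N → Fin (2 * N))
    (hβ : IsLinkPattern N a b) :
    ContDiffOn ℝ (⊤ : ℕ∞) (Fbeta N a b) (chamber (2 * N)) ∧
      ∀ j : Fin (2 * N), ∀ x ∈ chamber (2 * N),
        (8 / 3 : ℝ) * pd (2 * N) (pd (2 * N) (Fbeta N a b) j) j x
            + ∑ i ∈ Finset.univ.erase j,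
                (2 / (x i - x j) * pd (2 * N) (Fbeta N a b) i x
                  - (1 / 8 : ℝ) * Fbeta N a b x / (x i - x j) ^ 2) = 0 := by
  refine ⟨(contDiffOn_Fbeta hβ).mono fun x hx => StrictMono.injective hx, fun j x hx => ?_⟩
  have hinj : Function.Injective x := StrictMono.injective hx
  exact bpz_of_quadratic (fun σ => linkCharge (linkEquiv hβ) σ) (fun σ => linkCharge_sq _ σ) _
    (fun y hy => Fbeta_eq_sqrt hβ hy) j x hinj
    (sum_quadratic_eq_zero _ hinj (linksDisjoint_linkEquiv hβ hx) j)
end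
end

section
/- Fix N ≥ 1 and a link pattern β ∈ LP_N. Let φ(x) = (ax+b)/(cx+d) with a,b,c,d ∈ ℝ and ad−bc > 0, and let x = (x_1,…,x_{2N}) ∈ 𝔛_{2N} be such that c·x_i + d ≠ 0 for all i and φ(x_1) < φ(x_2) < ⋯ < φ(x_{2N}). Then F_β(x_1,…,x_{2N}) = ∏_{i=1}^{2N} φ'(x_i)^{1/16} · F_β(φ(x_1),…,φ(x_{2N})), where φ'(x_i) = (ad−bc)/(c·x_i+d)² > 0. (This is the Möbius covariance of F_β with conformal weight h = 1/16, corresponding to κ = 16/3.) -/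
open Filter Topology

noncomputable section

/-- A Möbius map scales distances by `(ad - bc) / (|cu + d| |cv + d|)`. -/
lemma abs_mobius_sub {a b c d u v : ℝ} (hdet : 0 < a * d - b * c)
    (hu : c * u + d ≠ 0) (hv : c * v + d ≠ 0) :
    |(a * u + b) / (c * u + d) - (a * v + b) / (c * v + d)|
      = (a * d - b * c) / (|c * u + d| * |c * v + d|) * |u - v| := by
  have h : (a * u + b) / (c * u + d) - (a * v + b) / (c * v + d)
      = (a * d - b * c) / ((c * u + d) * (c * v + d)) * (u - v) := by
    rw [div_sub_div _ _ hu hv]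
    ring
  rw [h, abs_mul, abs_div, abs_mul, abs_of_pos hdet]

/-- The cross-ratio is invariant under Möbius maps. -/
lemma crossRatioR_mobius {a b c d y₁ y₂ y₃ y₄ : ℝ} (hdet : 0 < a * d - b * c)
    (h₁ : c * y₁ + d ≠ 0) (h₂ : c * y₂ + d ≠ 0) (h₃ : c * y₃ + d ≠ 0) (h₄ : c * y₄ + d ≠ 0) :
    crossRatioR ((a * y₁ + b) / (c * y₁ + d)) ((a * y₂ + b) / (c * y₂ + d))
      ((a * y₃ + b) / (c * y₃ + d)) ((a * y₄ + b) / (c * y₄ + d)) = crossRatioR y₁ y₂ y₃ y₄ := by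
  simp only [crossRatioR, abs_mobius_sub hdet, h₁, h₂, h₃, h₄, ne_eq, not_false_eq_true]
  have hk : (a * d - b * c) ^ 2 /
      (|c * y₁ + d| * |c * y₂ + d| * |c * y₃ + d| * |c * y₄ + d|) ≠ 0 := by
    have := hdet.ne'
    positivity
  rw [← mul_div_mul_left (|y₂ - y₁| * |y₄ - y₃|) (|y₃ - y₁| * |y₄ - y₂|) hk]
  congr 1 <;> ring

/-- The link factor of `F_β` is covariant with conformal weight `1/16` at both endpoints. -/
lemma abs_sub_rpow_mobius {a b c d u v : ℝ} (hdet : 0 < a * d - b * c)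
    (hu : c * u + d ≠ 0) (hv : c * v + d ≠ 0) :
    |u - v| ^ (-(1 / 8) : ℝ)
      = ((a * d - b * c) / (c * v + d) ^ 2) ^ ((1 : ℝ) / 16)
        * ((a * d - b * c) / (c * u + d) ^ 2) ^ ((1 : ℝ) / 16)
        * |(a * u + b) / (c * u + d) - (a * v + b) / (c * v + d)| ^ (-(1 / 8) : ℝ) := by
  have hk : 0 < (a * d - b * c) / (|c * u + d| * |c * v + d|) := by positivity
  have hsq : (a * d - b * c) / (c * v + d) ^ 2 * ((a * d - b * c) / (c * u + d) ^ 2)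
      = ((a * d - b * c) / (|c * u + d| * |c * v + d|)) ^ (2 : ℝ) := by
    rw [Real.rpow_two, div_pow, mul_pow, sq_abs, sq_abs, div_mul_div_comm]
    ring
  rw [abs_mobius_sub hdet hu hv, Real.mul_rpow hk.le (abs_nonneg _),
    ← Real.mul_rpow (by positivity) (by positivity), hsq, ← Real.rpow_mul hk.le, ← mul_assoc,
    ← Real.rpow_add hk]
  norm_num

/-- A product over all points is a product over the links of a link pattern. -/
lemma IsLinkPattern.prod_eq {N : ℕ} {la lb : Fin N → Fin (2 * N)} (hβ : IsLinkPattern N la lb)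
    (f : Fin (2 * N) → ℝ) : ∏ i, f i = ∏ r, f (la r) * f (lb r) := by
  rw [← hβ.1.prod_comp f, Fintype.prod_prod_type]
  simp

/-- Möbius covariance of `F_β` with conformal weight `h = 1/16`. -/
theorem Fbeta_mobius_covariance (N : ℕ) (hN : 1 ≤ N) (la lb : Fin N → Fin (2 * N))
    (hβ : IsLinkPattern N la lb)
    (a b c d : ℝ) (hdet : a * d - b * c > 0)
    (x : Fin (2 * N) → ℝ) (hx : StrictMono x)
    (hden : ∀ i, c * x i + d ≠ 0)
    (hmono : StrictMono fun i => (a * x i + b) / (c * x i + d)) :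
    Fbeta N la lb x
      = (∏ i : Fin (2 * N), ((a * d - b * c) / (c * x i + d) ^ 2) ^ ((1 : ℝ) / 16))
          * Fbeta N la lb (fun i => (a * x i + b) / (c * x i + d)) := by
  have hcr : ∀ s t : Fin N, _ := fun s t =>
    crossRatioR_mobius hdet (hden (la s)) (hden (la t)) (hden (lb t)) (hden (lb s))
  simp only [Fbeta, hcr]
  rw [hβ.prod_eq, ← mul_assoc, ← Finset.prod_mul_distrib]
  congr 1
  exact Finset.prod_congr rfl fun r _ => abs_sub_rpow_mobius hdet (hden _) (hden _)
end
end

section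
/- Fix N ≥ 1, a link pattern β ∈ LP_N, and j ∈ {1,…,2N−1} such that {j,j+1} ∈ β. Fix points x_1 < ⋯ < x_{j−1} < x_{j+2} < ⋯ < x_{2N} and ξ ∈ (x_{j−1}, x_{j+2}) (with the conventions x_0 = −∞, x_{2N+1} = +∞). Then, in the limit as x_j and x_{j+1} both tend to ξ subject to x_{j−1} < x_j < x_{j+1} < x_{j+2}, one has F_β(x_1,…,x_{2N}) / (x_{j+1}−x_j)^{−1/8} → √2 · F_{β/{j,j+1}}(ẍ_j). -/
open Filter Topology

noncomputable section

/-- The order-preserving embedding of `{0,…,2N-3}` into `{0,…,2N-1}` skipping the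
positions `j` and `j+1`; it realizes the relabeling used in `β/{j,j+1}` and `ẍ_j`. -/
def skipTwo {N : ℕ} (j : Fin (2 * N)) (i : Fin (2 * (N - 1))) : Fin (2 * N) :=
  if h : i.val < j.val then ⟨i.val, lt_trans h j.isLt⟩
  else ⟨i.val + 2, by have := i.isLt; omega⟩

/-- The product of link lengths to the power `-1/8`, with `u` and `v` the left and right
endpoints of the links. -/
def linkProd {n : ℕ} (u v : Fin n → ℝ) : ℝ :=
  ∏ r : Fin n, |v r - u r| ^ (-(1 / 8) : ℝ)

/-- The sum over spin configurations entering `Fbeta`, with `u` and `v` the left and right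
endpoints of the links. -/
def linkSum {n : ℕ} (u v : Fin n → ℝ) : ℝ :=
  ∑ σ : Fin n → Bool, ∏ s : Fin n, ∏ t : Fin n,
    if s < t then crossRatioR (u s) (u t) (v t) (v s) ^ (sgn (σ s) * sgn (σ t) / 4) else 1

theorem Fbeta_eq_linkProd_mul_linkSum (N : ℕ) (a b : Fin N → Fin (2 * N))
    (x : Fin (2 * N) → ℝ) :
    Fbeta N a b x = linkProd (x ∘ a) (x ∘ b) * linkSum (x ∘ a) (x ∘ b) ^ ((1 : ℝ) / 2) :=
  rfl

theorem linkProd_succAbove {n : ℕ} (r : Fin (n + 1)) (u v : Fin (n + 1) → ℝ) :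
    linkProd u v =
      |v r - u r| ^ (-(1 / 8) : ℝ) * linkProd (u ∘ r.succAbove) (v ∘ r.succAbove) :=
  Fin.prod_univ_succAbove _ r

theorem crossRatioR_eq_one_of_inner_eq {p q z : ℝ} (hp : p ≠ z) (hq : q ≠ z) :
    crossRatioR p z z q = 1 := by
  have h₁ : |z - p| ≠ 0 := abs_ne_zero.2 (sub_ne_zero.2 hp.symm)
  have h₂ : |q - z| ≠ 0 := abs_ne_zero.2 (sub_ne_zero.2 hq)
  exact div_self (mul_ne_zero h₁ h₂)

theorem crossRatioR_eq_one_of_outer_eq {p q z : ℝ} (hp : p ≠ z) (hq : q ≠ z) :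
    crossRatioR z p q z = 1 := by
  have h₁ : |p - z| ≠ 0 := abs_ne_zero.2 (sub_ne_zero.2 hp)
  have h₂ : |q - z| ≠ 0 := abs_ne_zero.2 (sub_ne_zero.2 hq)
  rw [crossRatioR, abs_sub_comm z q, abs_sub_comm z p, mul_comm]
  exact div_self (mul_ne_zero h₂ h₁)

/-- A link whose endpoints coincide decouples from the others, and contributes a factor `2`. -/
theorem linkSum_of_collapsed_link {n : ℕ} (r : Fin (n + 1)) {u v : Fin (n + 1) → ℝ}
    (huv : v r = u r) (hu : ∀ s, s ≠ r → u s ≠ u r) (hv : ∀ s, s ≠ r → v s ≠ u r) :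
    linkSum u v = 2 * linkSum (u ∘ r.succAbove) (v ∘ r.succAbove) := by
  have hout (t : Fin n) :
      crossRatioR (u r) (u (r.succAbove t)) (v (r.succAbove t)) (u r) = 1 :=
    crossRatioR_eq_one_of_outer_eq (hu _ (r.succAbove_ne t)) (hv _ (r.succAbove_ne t))
  have hin (s : Fin n) :
      crossRatioR (u (r.succAbove s)) (u r) (u r) (v (r.succAbove s)) = 1 :=
    crossRatioR_eq_one_of_inner_eq (hu _ (r.succAbove_ne s)) (hv _ (r.succAbove_ne s))
  unfold linkSum
  rw [← (Fin.insertNthEquiv (fun _ => Bool) r).sum_comp, Fintype.sum_prod_type]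
  simp [Fin.prod_univ_succAbove _ r, huv, hout, hin, (Fin.strictMono_succAbove r).lt_iff_lt,
    two_mul]

theorem continuousAt_linkProd {n : ℕ} {w : (Fin n → ℝ) × (Fin n → ℝ)}
    (h : ∀ r, w.1 r ≠ w.2 r) :
    ContinuousAt (fun w : (Fin n → ℝ) × (Fin n → ℝ) => linkProd w.1 w.2) w := by
  unfold linkProd
  refine tendsto_finsetProd _ fun r _ => ?_
  refine ContinuousAt.rpow_const (by fun_prop) (Or.inl ?_)
  exact abs_ne_zero.2 (sub_ne_zero.2 (h r).symm)

theorem continuousAt_linkSum {n : ℕ} {w : (Fin n → ℝ) × (Fin n → ℝ)}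
    (h₁ : ∀ s t, s ≠ t → w.1 s ≠ w.1 t) (h₂ : ∀ s t, s ≠ t → w.2 s ≠ w.2 t)
    (h₁₂ : ∀ s t, s ≠ t → w.1 s ≠ w.2 t) :
    ContinuousAt (fun w : (Fin n → ℝ) × (Fin n → ℝ) => linkSum w.1 w.2) w := by
  unfold linkSum
  refine tendsto_finsetSum _ fun σ _ => tendsto_finsetProd _ fun s _ =>
    tendsto_finsetProd _ fun t _ => ?_
  split_ifs with hst
  · have hne := hst.ne
    have e₁ := abs_ne_zero.2 (sub_ne_zero.2 (h₁ t s hne.symm))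
    have e₂ := abs_ne_zero.2 (sub_ne_zero.2 (h₂ s t hne))
    have e₃ := abs_ne_zero.2 (sub_ne_zero.2 (h₁₂ s t hne).symm)
    have e₄ := abs_ne_zero.2 (sub_ne_zero.2 (h₁₂ t s hne.symm).symm)
    refine ContinuousAt.rpow_const ?_ (Or.inl ?_)
    · unfold crossRatioR
      exact ContinuousAt.div (by fun_prop) (by fun_prop) (mul_ne_zero e₃ e₄)
    · exact div_ne_zero (mul_ne_zero e₁ e₂) (mul_ne_zero e₃ e₄)
  · exact tendsto_const_nhds

/-- A strictly increasing map `Fin n → Fin (n + 1)` avoiding `r` is `r.succAbove`. -/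
theorem eq_succAbove_of_strictMono {n : ℕ} {r : Fin (n + 1)} {c : Fin n → Fin (n + 1)}
    (hc : StrictMono c) (hr : ∀ k, c k ≠ r) : c = r.succAbove := by
  choose d hd using fun k => Fin.exists_succAbove_eq (hr k)
  have hdm : StrictMono d := fun i k hik => by
    have := hc hik
    rwa [← hd, ← hd, (Fin.strictMono_succAbove r).lt_iff_lt] at this
  have hdid : d = id := (hdm.range_inj strictMono_id).1 <| by
    rw [(Finite.surjective_of_injective hdm.injective).range_eq, Set.range_id]
  funext k
  rw [← hd k, hdid, id]

theorem skipTwo_strictMono {N : ℕ} (j : Fin (2 * N)) : StrictMono (skipTwo j) := by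
  intro i k hik
  rw [Fin.lt_def] at hik ⊢
  unfold skipTwo
  split_ifs <;> simp only <;> omega

theorem skipTwo_ne {N : ℕ} (j : Fin (2 * N)) (i : Fin (2 * (N - 1))) : skipTwo j i ≠ j := by
  intro h
  have := congrArg Fin.val h
  unfold skipTwo at this
  split_ifs at this <;> simp only at this <;> omega

theorem skipTwo_val_ne_succ {N : ℕ} (j : Fin (2 * N)) (i : Fin (2 * (N - 1))) :
    (skipTwo j i).val ≠ j.val + 1 := by
  intro this
  unfold skipTwo at this
  split_ifs at this <;> simp only at this <;> omega

/-- asymptotics of `F_β` as `x_j, x_{j+1} → ξ` when `{j, j+1} ∈ β`: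
the renormalized value tends to `√2 · F_{β/{j,j+1}}(ẍ_j)`.
Here `a' b'` encode `β/{j,j+1}` (via the order-preserving relabeling `skipTwo j`). -/
theorem Fbeta_asymptotics_link (N : ℕ) (hN : 1 ≤ N) (a b : Fin N → Fin (2 * N))
    (hβ : IsLinkPattern N a b)
    (j : Fin (2 * N)) (hj : j.val + 1 < 2 * N)
    (hlink : ∃ r : Fin N, a r = j ∧ (b r).val = j.val + 1)
    (x : Fin (2 * N) → ℝ) (ξ : ℝ)
    (hx : ∀ i i' : Fin (2 * N), i < i' →
      i.val ≠ j.val → i.val ≠ j.val + 1 → i'.val ≠ j.val → i'.val ≠ j.val + 1 → x i < x i')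
    (hlo : ∀ i : Fin (2 * N), i.val < j.val → x i < ξ)
    (hhi : ∀ i : Fin (2 * N), j.val + 1 < i.val → ξ < x i)
    (a' b' : Fin (N - 1) → Fin (2 * (N - 1))) (hβ' : IsLinkPattern (N - 1) a' b')
    (hcorr : ∀ r : Fin (N - 1), ∃ s : Fin N,
      skipTwo j (a' r) = a s ∧ skipTwo j (b' r) = b s) :
    Tendsto
      (fun p : ℝ × ℝ =>
        Fbeta N a b (Function.update (Function.update x j p.1) ⟨j.val + 1, hj⟩ p.2)
          / (p.2 - p.1) ^ (-(1 / 8) : ℝ))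
      (𝓝[{p : ℝ × ℝ |
          StrictMono (Function.update (Function.update x j p.1) ⟨j.val + 1, hj⟩ p.2)}] (ξ, ξ))
      (𝓝 (Real.sqrt 2 * Fbeta (N - 1) a' b' fun i => x (skipTwo j i))) := by
  obtain _ | M := N
  · omega
  obtain ⟨r, rfl, hbr⟩ := hlink
  obtain ⟨hbij, ha, hab, -⟩ := hβ
  have hb_succ : b r = ⟨(a r).val + 1, hj⟩ := Fin.ext hbr
  have ha_inj := ha.injective
  have hb_inj (s t : Fin (M + 1)) (h : b s = b t) : s = t :=
    congrArg Prod.fst (@hbij.1 (s, false) (t, false) h)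
  have hab_ne (s t : Fin (M + 1)) : a s ≠ b t := fun h => by
    simpa using congrArg Prod.snd (@hbij.1 (s, true) (t, false) h)
  obtain ⟨c, hac, hbc⟩ : ∃ c : Fin M → Fin (M + 1),
      (∀ k : Fin M, skipTwo (a r) (a' k) = a (c k)) ∧
        ∀ k : Fin M, skipTwo (a r) (b' k) = b (c k) := by
    choose c hc using hcorr
    exact ⟨c, fun k => (hc k).1, fun k => (hc k).2⟩
  have hc : c = r.succAbove := by
    refine eq_succAbove_of_strictMono (fun i k hik => ?_) fun k hk => ?_
    · rw [← ha.lt_iff_lt, ← hac, ← hac]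
      exact skipTwo_strictMono _ (hβ'.2.1 hik)
    · exact skipTwo_ne (a r) (a' k) ((hac k).trans (congrArg a hk))
  subst hc
  set y : ℝ × ℝ → Fin (2 * (M + 1)) → ℝ := fun p =>
    Function.update (Function.update x (a r) p.1) ⟨(a r).val + 1, hj⟩ p.2 with hy
  have hya (p : ℝ × ℝ) : y p (a r) = p.1 := by
    have : a r ≠ ⟨(a r).val + 1, hj⟩ := hb_succ ▸ hab_ne r r
    simp [hy, Function.update_of_ne this]
  have hyb (p : ℝ × ℝ) : y p (b r) = p.2 := by simp [hy, hb_succ]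
  have hy_of_ne (p : ℝ × ℝ) (i : Fin (2 * (M + 1))) (h₁ : i ≠ a r) (h₂ : i ≠ b r) :
      y p i = x i := by
    rw [hb_succ] at h₂
    simp [hy, Function.update_of_ne h₁, Function.update_of_ne h₂]
  have hy_cont : Continuous y := by
    have h : Continuous fun p : ℝ × ℝ => Function.update x (a r) p.1 :=
      continuous_const.update _ continuous_fst
    exact h.update _ continuous_snd
  have hξ (i : Fin (2 * (M + 1))) (h₁ : i ≠ a r) (h₂ : i ≠ b r) : x i ≠ ξ := by
    rw [Ne, Fin.ext_iff] at h₁ h₂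
    rcases lt_or_ge i.val (a r).val with h | h
    · exact (hlo i h).ne
    · exact (hhi i (by omega)).ne'
  have hx_ne (i k : Fin (2 * (M + 1))) (hi₁ : i ≠ a r) (hi₂ : i ≠ b r) (hk₁ : k ≠ a r)
      (hk₂ : k ≠ b r) (hik : i ≠ k) : x i ≠ x k := by
    rw [Ne, Fin.ext_iff] at hi₁ hi₂ hk₁ hk₂
    rw [hbr] at hi₂ hk₂
    rcases hik.lt_or_gt with h | h
    · exact (hx i k h hi₁ hi₂ hk₁ hk₂).ne
    · exact (hx k i h hk₁ hk₂ hi₁ hi₂).ne'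
  -- Endpoints of distinct links remain distinct in the limit.
  have hy_ne (s t : Fin (M + 1)) (hst : s ≠ t) (i k : Fin (2 * (M + 1)))
      (hi : i = a s ∨ i = b s) (hk : k = a t ∨ k = b t) : y (ξ, ξ) i ≠ y (ξ, ξ) k := by
    have hnot (s t : Fin (M + 1)) (hst : s ≠ t) (i : Fin (2 * (M + 1)))
        (hi : i = a s ∨ i = b s) : i ≠ a t ∧ i ≠ b t := by
      rcases hi with rfl | rfl
      · exact ⟨ha_inj.ne hst, hab_ne _ _⟩
      · exact ⟨(hab_ne _ _).symm, fun h => hst (hb_inj _ _ h)⟩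
    have hlim (i : Fin (2 * (M + 1))) (hi : i = a r ∨ i = b r) : y (ξ, ξ) i = ξ := by
      rcases hi with rfl | rfl
      exacts [hya _, hyb _]
    by_cases hs : s = r
    · subst hs
      have hk' := hnot t s hst.symm k hk
      rw [hlim i hi, hy_of_ne _ _ hk'.1 hk'.2]
      exact (hξ k hk'.1 hk'.2).symm
    · have hi' := hnot s r hs i hi
      rw [hy_of_ne _ _ hi'.1 hi'.2]
      by_cases ht : t = r
      · subst ht
        rw [hlim k hk]
        exact hξ i hi'.1 hi'.2
      · have hk' := hnot t r ht k hk
        rw [hy_of_ne _ _ hk'.1 hk'.2]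
        refine hx_ne i k hi'.1 hi'.2 hk'.1 hk'.2 fun h => ?_
        have hik := hnot s t hst i hi
        rcases hk with hk | hk
        exacts [hik.1 (h.trans hk), hik.2 (h.trans hk)]
  have hy_self (s : Fin (M + 1)) (hs : s ≠ r) : y (ξ, ξ) (a s) ≠ y (ξ, ξ) (b s) := by
    have h₁ : a s ≠ a r := ha_inj.ne hs
    have h₂ : b s ≠ b r := fun h => hs (hb_inj _ _ h)
    rw [hy_of_ne _ _ h₁ (hab_ne _ _), hy_of_ne _ _ (hab_ne _ _).symm h₂]
    exact hx_ne _ _ h₁ (hab_ne _ _) (hab_ne _ _).symm h₂ (hab_ne _ _)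
  have hlimit_a : (y (ξ, ξ) ∘ a) ∘ r.succAbove = (fun i => x (skipTwo (a r) i)) ∘ a' := by
    funext k
    have h : y (ξ, ξ) (a (r.succAbove k)) = x (a (r.succAbove k)) :=
      hy_of_ne _ _ (ha_inj.ne (r.succAbove_ne k)) (hab_ne _ _)
    exact h.trans (congrArg x (hac k).symm)
  have hlimit_b : (y (ξ, ξ) ∘ b) ∘ r.succAbove = (fun i => x (skipTwo (a r) i)) ∘ b' := by
    funext k
    have h : y (ξ, ξ) (b (r.succAbove k)) = x (b (r.succAbove k)) :=
      hy_of_ne _ _ (hab_ne _ _).symm fun h => r.succAbove_ne k (hb_inj _ _ h)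
    exact h.trans (congrArg x (hbc k).symm)
  have hprod : ContinuousAt (fun p : ℝ × ℝ =>
      linkProd ((y p ∘ a) ∘ r.succAbove) ((y p ∘ b) ∘ r.succAbove)) (ξ, ξ) :=
    ContinuousAt.comp (f := fun p : ℝ × ℝ =>
        ((y p ∘ a) ∘ r.succAbove, (y p ∘ b) ∘ r.succAbove))
      (continuousAt_linkProd fun k => hy_self _ (r.succAbove_ne k))
      (Continuous.continuousAt (by fun_prop))
  have hsum : ContinuousAt (fun p : ℝ × ℝ => linkSum (y p ∘ a) (y p ∘ b)) (ξ, ξ) :=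
    ContinuousAt.comp (f := fun p : ℝ × ℝ => (y p ∘ a, y p ∘ b))
      (continuousAt_linkSum
        (fun s t hst => hy_ne s t hst _ _ (Or.inl rfl) (Or.inl rfl))
        (fun s t hst => hy_ne s t hst _ _ (Or.inr rfl) (Or.inr rfl))
        (fun s t hst => hy_ne s t hst _ _ (Or.inl rfl) (Or.inr rfl)))
      (Continuous.continuousAt (by fun_prop))
  have hmain := hprod.tendsto.mul
    (hsum.tendsto.rpow_const (p := (1 : ℝ) / 2) (Or.inr (by norm_num)))
  have hcollapse : linkSum (y (ξ, ξ) ∘ a) (y (ξ, ξ) ∘ b) =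
      2 * linkSum ((y (ξ, ξ) ∘ a) ∘ r.succAbove) ((y (ξ, ξ) ∘ b) ∘ r.succAbove) :=
    linkSum_of_collapsed_link r ((hyb (ξ, ξ)).trans (hya (ξ, ξ)).symm)
      (fun s hs => hy_ne s r hs _ _ (Or.inl rfl) (Or.inl rfl))
      (fun s hs => hy_ne s r hs _ _ (Or.inr rfl) (Or.inl rfl))
  have hvalue : linkProd ((y (ξ, ξ) ∘ a) ∘ r.succAbove) ((y (ξ, ξ) ∘ b) ∘ r.succAbove) *
      linkSum (y (ξ, ξ) ∘ a) (y (ξ, ξ) ∘ b) ^ ((1 : ℝ) / 2) =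
      Real.sqrt 2 * Fbeta (M + 1 - 1) a' b' fun i => x (skipTwo (a r) i) := by
    rw [hcollapse, ← Real.sqrt_eq_rpow, Real.sqrt_mul zero_le_two, hlimit_a, hlimit_b,
      Fbeta_eq_linkProd_mul_linkSum, ← Real.sqrt_eq_rpow]
    exact mul_left_comm _ _ _
  rw [hvalue] at hmain
  refine (hmain.mono_left nhdsWithin_le_nhds).congr' ?_
  filter_upwards [self_mem_nhdsWithin] with p hp
  have hlt : p.1 < p.2 := by
    have h : y p (a r) < y p (b r) := hp (hab r)
    rwa [hya, hyb] at h
  have hpos : 0 < p.2 - p.1 := sub_pos.2 hlt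
  have hlen : |(y p ∘ b) r - (y p ∘ a) r| = p.2 - p.1 := by
    rw [Function.comp_apply, Function.comp_apply, hya, hyb, abs_of_pos hpos]
  change _ = Fbeta (M + 1) a b (y p) / _
  rw [Fbeta_eq_linkProd_mul_linkSum, linkProd_succAbove r, hlen, mul_assoc,
    mul_div_cancel_left₀ _ (Real.rpow_pos_of_pos hpos _).ne']
end
end

section
/- For every N ≥ 2, every x = (x_1,…,x_{2N}) ∈ 𝔛_{2N}, and every pair of indices 1 ≤ r < s ≤ N, one has Y^{(N)}(x_1,…,x_{2N}) ≥ χ(x_{2r−1}, x_{2s−1}, x_{2s}, x_{2r})^{1/8}. -/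
noncomputable section

/-- The index of `x_{2r-1}` (1-indexed), i.e. `2r` (0-indexed). -/
def idxA (N : ℕ) (r : Fin N) : Fin (2 * N) := ⟨2 * r.val, by have := r.isLt; omega⟩

/-- The index of `x_{2r}` (1-indexed), i.e. `2r+1` (0-indexed). -/
def idxB (N : ℕ) (r : Fin N) : Fin (2 * N) := ⟨2 * r.val + 1, by have := r.isLt; omega⟩

/-- The quantity `Y^{(N)}(x) = (∑_{σ∈{±1}^N} ∏_{s<t} χ(x_{2s-1},x_{2t-1},x_{2t},x_{2s})^{σ_sσ_t/4})^{1/2}`. -/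
def Ynn (N : ℕ) (x : Fin (2 * N) → ℝ) : ℝ :=
  (∑ σ : Fin N → Bool, ∏ s : Fin N, ∏ t : Fin N,
      if s < t then
        crossRatioR (x (idxA N s)) (x (idxA N t)) (x (idxB N t)) (x (idxB N s))
          ^ (sgn (σ s) * sgn (σ t) / 4)
      else 1) ^ ((1 : ℝ) / 2)

theorem one_le_crossRatioR {p q u v : ℝ} (hpq : p < q) (hqu : q < u) (huv : u < v) :
    1 ≤ crossRatioR p u v q := by
  have hd : 0 < |v - p| * |q - u| :=
    mul_pos (abs_pos.2 (by linarith)) (abs_pos.2 (by linarith))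
  rw [crossRatioR, one_le_div hd, abs_of_pos (by linarith : 0 < v - p),
    abs_of_neg (by linarith : q - u < 0), abs_of_pos (by linarith : 0 < u - p),
    abs_of_neg (by linarith : q - v < 0)]
  nlinarith [mul_pos (sub_pos.2 hpq) (sub_pos.2 huv)]

theorem one_le_crossRatioR_idx {N : ℕ} {x : Fin (2 * N) → ℝ} (hx : StrictMono x)
    {s t : Fin N} (hst : s < t) :
    1 ≤ crossRatioR (x (idxA N s)) (x (idxA N t)) (x (idxB N t)) (x (idxB N s)) := by
  have hst' : s.val < t.val := hst
  apply one_le_crossRatioR <;> apply hx <;> simp only [idxA, idxB, Fin.mk_lt_mk] <;> omega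

theorem one_le_prod_of_forall_one_le {ι : Type*} (S : Finset ι) (f : ι → ℝ)
    (hf : ∀ i, 1 ≤ f i) : 1 ≤ ∏ i ∈ S, f i :=
  Finset.prod_induction f (1 ≤ ·) (fun _ _ => one_le_mul_of_one_le_of_one_le) le_rfl
    fun i _ => hf i

theorem le_prod_univ_of_forall_one_le {ι : Type*} [Fintype ι] (f : ι → ℝ)
    (hf : ∀ i, 1 ≤ f i) (i : ι) : f i ≤ ∏ j, f j := by
  classical
  rw [← Finset.mul_prod_erase Finset.univ f (Finset.mem_univ i)]
  exact le_mul_of_one_le_right (zero_le_one.trans (hf i)) (one_le_prod_of_forall_one_le _ f hf)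

/-- for `N ≥ 2` and `1 ≤ r < s ≤ N`,
`Y^{(N)}(x) ≥ χ(x_{2r-1}, x_{2s-1}, x_{2s}, x_{2r})^{1/8}`. -/
theorem Ynn_ge_crossRatio (N : ℕ) (hN : 2 ≤ N) (x : Fin (2 * N) → ℝ) (hx : StrictMono x)
    (r s : Fin N) (hrs : r < s) :
    crossRatioR (x (idxA N r)) (x (idxA N s)) (x (idxB N s)) (x (idxB N r)) ^ ((1 : ℝ) / 8)
      ≤ Ynn N x := by
  set c : Fin N → Fin N → ℝ := fun s t =>
    crossRatioR (x (idxA N s)) (x (idxA N t)) (x (idxB N t)) (x (idxB N s)) with hc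
  have hc_one : ∀ s t, s < t → 1 ≤ c s t := fun s t => one_le_crossRatioR_idx hx
  set f : Fin N → Fin N → ℝ := fun s t => if s < t then c s t ^ ((1 : ℝ) / 4) else 1 with hf
  have hf_one : ∀ s t, 1 ≤ f s t := by
    intro s t
    simp only [hf]
    split_ifs with h
    · exact Real.one_le_rpow (hc_one s t h) (by norm_num)
    · exact le_rfl
  have hterm : c r s ^ ((1 : ℝ) / 4) ≤ ∏ s, ∏ t, f s t := by
    calc c r s ^ ((1 : ℝ) / 4) = f r s := by simp [hf, hrs]
      _ ≤ ∏ t, f r t := le_prod_univ_of_forall_one_le (f r) (hf_one r) s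
      _ ≤ ∏ s, ∏ t, f s t := le_prod_univ_of_forall_one_le (fun s => ∏ t, f s t)
          (fun s => one_le_prod_of_forall_one_le _ _ (hf_one s)) r
  have hsum : ∏ s, ∏ t, f s t ≤ ∑ σ : Fin N → Bool, ∏ s : Fin N, ∏ t : Fin N,
      if s < t then c s t ^ (sgn (σ s) * sgn (σ t) / 4) else 1 := by
    refine le_trans (le_of_eq ?_) (Finset.single_le_sum (fun σ _ => ?_)
      (Finset.mem_univ fun _ : Fin N => true))
    · simp [hf, sgn]
    · refine Finset.prod_nonneg fun s _ => Finset.prod_nonneg fun t _ => ?_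
      split_ifs with h
      · exact Real.rpow_nonneg (zero_le_one.trans (hc_one s t h)) _
      · exact zero_le_one
  have hpos : 0 ≤ c r s := zero_le_one.trans (hc_one r s hrs)
  calc c r s ^ ((1 : ℝ) / 8) = (c r s ^ ((1 : ℝ) / 4)) ^ ((1 : ℝ) / 2) := by
        rw [← Real.rpow_mul hpos]; norm_num
    _ ≤ Ynn N x :=
        Real.rpow_le_rpow (Real.rpow_nonneg hpos _) (hterm.trans hsum) (by norm_num)
end
end

section
/- Let κ > 4, λ > 0, μ > 0 with μ < 1/λ, and ν with μλ ≤ ν < 1. Then ∫_{μλ}^{ν} u^{−4/κ} (u+λ)^{−4/κ} du = (κ/(κ−4)) · λ^{−4/κ} · ( ν^{1−4/κ} · ₂F₁(4/κ, 1−4/κ, 2−4/κ; −ν/λ) − (μλ)^{1−4/κ} · ₂F₁(4/κ, 1−4/κ, 2−4/κ; −μ) ). -/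
noncomputable section

/-- The Gauss hypergeometric function `₂F₁(a,b,c;z)`, given (for `c > b > 0` and `z ≤ 0`)
by the Euler integral representation. -/
def gauss2F1 (a b c z : ℝ) : ℝ :=
  Real.Gamma c / (Real.Gamma b * Real.Gamma (c - b))
    * ∫ t in (0 : ℝ)..1, t ^ (b - 1) * (1 - t) ^ (c - b - 1) * (1 - z * t) ^ (-a)

/-- With `c = b + 1`, the Euler integral loses its factor in `1 - t` and the Gamma quotient
reduces to `b`. -/
theorem gauss2F1_one_sub_two_sub {α : ℝ} (hα : α < 1) (z : ℝ) :
    gauss2F1 α (1 - α) (2 - α) z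
      = (1 - α) * ∫ t in (0 : ℝ)..1, t ^ (-α) * (1 - z * t) ^ (-α) := by
  have hα' : 0 < 1 - α := sub_pos.2 hα
  have hΓ : Real.Gamma (2 - α) = (1 - α) * Real.Gamma (1 - α) := by
    rw [← Real.Gamma_add_one hα'.ne']
    ring_nf
  have hb : 1 - α - 1 = -α := by ring
  have hc : 2 - α - (1 - α) = 1 := by ring
  have hΓ' := (Real.Gamma_pos_of_pos hα').ne'
  rw [gauss2F1, hΓ, hb, hc, Real.Gamma_one, mul_one, mul_div_cancel_right₀ _ hΓ']
  simp only [sub_self, Real.rpow_zero, mul_one]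

/-- The incomplete integral from `0` as a hypergeometric function. -/
theorem integral_zero_eq_gauss2F1 {α lam x : ℝ} (hα : α < 1) (hlam : 0 < lam) (hx : 0 < x) :
    (1 - α) * ∫ u in (0 : ℝ)..x, u ^ (-α) * (u + lam) ^ (-α)
      = lam ^ (-α) * (x ^ (1 - α) * gauss2F1 α (1 - α) (2 - α) (-(x / lam))) := by
  have hsubst := intervalIntegral.smul_integral_comp_mul_left (a := 0) (b := 1)
    (fun u : ℝ => u ^ (-α) * (u + lam) ^ (-α)) x
  rw [mul_zero, mul_one, smul_eq_mul] at hsubst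
  have hint : ∫ t in (0 : ℝ)..1, (x * t) ^ (-α) * (x * t + lam) ^ (-α)
      = x ^ (-α) * lam ^ (-α)
        * ∫ t in (0 : ℝ)..1, t ^ (-α) * (1 - -(x / lam) * t) ^ (-α) := by
    rw [← intervalIntegral.integral_const_mul]
    refine intervalIntegral.integral_congr fun t ht => ?_
    rw [Set.uIcc_of_le zero_le_one] at ht
    have ht0 := ht.1
    have hfactor : x * t + lam = lam * (1 - -(x / lam) * t) := by
      field_simp
      ring
    have hpos : 0 ≤ 1 - -(x / lam) * t := by
      rw [neg_mul, sub_neg_eq_add]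
      positivity
    rw [hfactor, Real.mul_rpow hx.le ht0, Real.mul_rpow hlam.le hpos]
    ring
  have hpow : x ^ (1 - α) = x * x ^ (-α) := by
    rw [sub_eq_add_neg, Real.rpow_add hx, Real.rpow_one]
  rw [← hsubst, hint, gauss2F1_one_sub_two_sub hα, hpow]
  ring

theorem intervalIntegrable_rpow_mul_add_rpow {α lam x : ℝ} (hα : α < 1) (hlam : 0 < lam)
    (hx : 0 ≤ x) :
    IntervalIntegrable (fun u : ℝ => u ^ (-α) * (u + lam) ^ (-α)) MeasureTheory.volume 0 x := by
  refine (intervalIntegral.intervalIntegrable_rpow' (by linarith)).mul_continuousOn ?_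
  refine ContinuousOn.rpow_const (by fun_prop) fun u hu => Or.inl ?_
  rw [Set.uIcc_of_le hx] at hu
  linarith [hu.1]

/-- evaluation of `∫_{μλ}^{ν} u^{-4/κ} (u+λ)^{-4/κ} du` in terms of `₂F₁`. -/
theorem integral_eq_gauss2F1 (κ lam μ ν : ℝ) (hκ : 4 < κ) (hlam : 0 < lam) (hμ : 0 < μ)
    (hμlam : μ < 1 / lam) (hlo : μ * lam ≤ ν) (hν : ν < 1) :
    ∫ u in (μ * lam)..ν, u ^ (-(4 / κ)) * (u + lam) ^ (-(4 / κ))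
      = κ / (κ - 4) * lam ^ (-(4 / κ))
          * (ν ^ (1 - 4 / κ) * gauss2F1 (4 / κ) (1 - 4 / κ) (2 - 4 / κ) (-(ν / lam))
              - (μ * lam) ^ (1 - 4 / κ) * gauss2F1 (4 / κ) (1 - 4 / κ) (2 - 4 / κ) (-μ)) := by
  have hκ0 : 0 < κ := by linarith
  have hα : 4 / κ < 1 := (div_lt_one hκ0).2 hκ
  have hx : 0 < μ * lam := mul_pos hμ hlam
  have hν0 : 0 < ν := hx.trans_le hlo
  have hupper := integral_zero_eq_gauss2F1 hα hlam hν0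
  have hlower := integral_zero_eq_gauss2F1 hα hlam hx
  rw [mul_div_cancel_right₀ μ hlam.ne'] at hlower
  have hcoef : κ / (κ - 4) * (1 - 4 / κ) = 1 := by
    have : κ - 4 ≠ 0 := by linarith
    field_simp
  rw [mul_assoc, mul_sub, ← hupper, ← hlower, ← mul_sub, ← mul_assoc, hcoef, one_mul,
    intervalIntegral.integral_interval_sub_left
      (intervalIntegrable_rpow_mul_add_rpow hα hlam hν0.le)
      (intervalIntegrable_rpow_mul_add_rpow hα hlam hx.le)]
end
end
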